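/- arXiv:2102.03060 — 9 statements merged into one kernel-verified Lean document; each statement's English description precedes it below -/
import Mathlib

section
/- Let d ≥ 2 be a natural number, M a natural number, and set τ = 4·log d (natural logarithm). Let v₁,…,v_m be random variables on a common probability space (not necessarily independent) with m ≤ d, such that each v_j has the Binomial(M, p_j) distribution with 0 ≤ p_j ≤ τ/(5M). Then Pr[ max_{1≤j≤m} v_j > τ ] ≤ 1/d. -/
open MeasureTheory Real

/-- The exponential moment of the binomial weights at `1`, i.e. the binomial theorem with the
success weight tilted by `exp 1`, bounded by that of the Poisson distribution of the same mean. -/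
lemma sum_binomial_mul_exp_le (M : ℕ) {q : ℝ} (hq0 : 0 ≤ q) (hq1 : q ≤ 1) :
    ∑ m ∈ Finset.range (M + 1), (M.choose m : ℝ) * q ^ m * (1 - q) ^ (M - m) * exp m ≤
      exp (M * q * (exp 1 - 1)) := by
  calc
    _ = (q * exp 1 + (1 - q)) ^ M := by
      rw [add_pow]
      refine Finset.sum_congr rfl fun m _ => ?_
      rw [mul_pow, ← exp_nat_mul, mul_one]
      ring
    _ ≤ exp (q * (exp 1 - 1)) ^ M := by
      gcongr
      linarith [add_one_le_exp (q * (exp 1 - 1))]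
    _ = exp (M * q * (exp 1 - 1)) := by
      rw [← exp_nat_mul, mul_assoc]

/-- Chernoff's bound with parameter `1` for the upper tail of a binomial random variable. -/
lemma measure_binomial_gt_le {Ω : Type*} [MeasurableSpace Ω] (P : Measure Ω) (M : ℕ) (τ : ℝ)
    (X : Ω → ℕ) {q : ℝ} (hq0 : 0 ≤ q) (hq1 : q ≤ 1)
    (hbin : ∀ m : ℕ,
      P {ω | X ω = m} = ENNReal.ofReal ((M.choose m : ℝ) * q ^ m * (1 - q) ^ (M - m))) :
    P {ω | τ < (X ω : ℝ)} ≤ ENNReal.ofReal (exp (M * q * (exp 1 - 1) - τ)) := by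
  have hq : 0 ≤ 1 - q := sub_nonneg.2 hq1
  let a : ℕ → ℝ := fun m => (M.choose m : ℝ) * q ^ m * (1 - q) ^ (M - m)
  have ha : ∀ m, 0 ≤ a m := fun m => by positivity
  have hcover : {ω | τ < (X ω : ℝ)} ⊆ ⋃ m : ℕ, {ω | X ω = m ∧ τ < (m : ℝ)} := fun ω hω =>
    Set.mem_iUnion.2 ⟨X ω, rfl, hω⟩
  have hterm (m : ℕ) : P {ω | X ω = m ∧ τ < (m : ℝ)} ≤ ENNReal.ofReal (a m * exp (m - τ)) := by
    by_cases hm : τ < (m : ℝ)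
    · simp only [hm, and_true, hbin]
      exact ENNReal.ofReal_le_ofReal
        (le_mul_of_one_le_right (ha m) (one_le_exp (sub_nonneg.2 hm.le)))
    · simp [hm]
  calc
    _ ≤ ∑' m, P {ω | X ω = m ∧ τ < (m : ℝ)} := (measure_mono hcover).trans (measure_iUnion_le _)
    _ ≤ ∑' m, ENNReal.ofReal (a m * exp (m - τ)) := ENNReal.tsum_le_tsum hterm
    _ = ∑ m ∈ Finset.range (M + 1), ENNReal.ofReal (a m * exp (m - τ)) := by
      refine tsum_eq_sum fun m hm => ?_
      have hMm : M < m := by simpa using hm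
      simp [a, Nat.choose_eq_zero_of_lt hMm]
    _ = ENNReal.ofReal (∑ m ∈ Finset.range (M + 1), a m * exp (m - τ)) :=
      (ENNReal.ofReal_sum_of_nonneg fun m _ => mul_nonneg (ha m) (exp_pos _).le).symm
    _ ≤ _ := by
      refine ENNReal.ofReal_le_ofReal ?_
      simp only [exp_sub, ← mul_div_assoc, ← Finset.sum_div]
      exact div_le_div_of_nonneg_right (sum_binomial_mul_exp_le M hq0 hq1) (exp_pos τ).le

/-- If `v₁,…,v_J` (J ≤ d) are (not necessarily independent) random variables with
`v_j ~ Binomial(M, p_j)` and `p_j ≤ τ/(5M)` where `τ = 4 log d`, then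
`Pr[max_j v_j > τ] ≤ 1/d`. -/
theorem sparse_means_nonsupport_votes_upper
    {Ω : Type*} [MeasurableSpace Ω] (P : Measure Ω) [IsProbabilityMeasure P]
    (d M J : ℕ) (hd : 2 ≤ d) (hJ : J ≤ d)
    (τ : ℝ) (hτ : τ = 4 * Real.log d)
    (v : Fin J → Ω → ℕ) (p : Fin J → ℝ)
    (hmeas : ∀ j, Measurable (v j))
    (hp0 : ∀ j, 0 ≤ p j) (hp1 : ∀ j, p j ≤ τ / (5 * M))
    (hbin : ∀ j, ∀ m : ℕ,
      P {ω | v j ω = m} =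
        ENNReal.ofReal ((M.choose m : ℝ) * p j ^ m * (1 - p j) ^ (M - m))) :
    P {ω | ∃ j : Fin J, τ < (v j ω : ℝ)} ≤ ENNReal.ofReal (1 / (d : ℝ)) := by
  have hd0 : (0 : ℝ) < d := by positivity
  have hτ0 : 0 ≤ τ := hτ ▸ mul_nonneg (by norm_num) (log_natCast_nonneg d)
  -- The weight of `m = M` is `p j ^ M`, which is a probability.
  have hp_le_one (j : Fin J) : p j ≤ 1 := by
    rcases Nat.eq_zero_or_pos M with rfl | hM
    · exact (hp1 j).trans (by simp)
    · have h := hbin j M ▸ prob_le_one (μ := P) (s := {ω | v j ω = M})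
      simp only [Nat.choose_self, Nat.cast_one, one_mul, Nat.sub_self, pow_zero, mul_one,
        ENNReal.ofReal_le_one] at h
      exact (pow_le_one_iff_of_nonneg (hp0 j) hM.ne').1 h
  have hmean (j : Fin J) : M * p j ≤ τ / 5 := by
    rcases Nat.eq_zero_or_pos M with rfl | hM
    · simpa using div_nonneg hτ0 (by norm_num : (0 : ℝ) ≤ 5)
    · have hM' : (0 : ℝ) < M := by exact_mod_cast hM
      have h := (le_div_iff₀ (by positivity)).1 (hp1 j)
      linarith
  have htail (j : Fin J) :
      P {ω | τ < (v j ω : ℝ)} ≤ ENNReal.ofReal (1 / (d : ℝ) ^ 2) := by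
    refine (measure_binomial_gt_le P M τ (v j) (hp0 j) (hp_le_one j) (hbin j)).trans
      (ENNReal.ofReal_le_ofReal ?_)
    have hexponent : M * p j * (exp 1 - 1) - τ ≤ -(2 * log d) := by
      have he : exp 1 - 1 ≤ 5 / 2 := by linarith [exp_one_lt_d9]
      have he0 : 0 ≤ exp 1 - 1 := by linarith [add_one_le_exp (1 : ℝ)]
      have h : M * p j * (exp 1 - 1) ≤ τ / 5 * (5 / 2) :=
        mul_le_mul (hmean j) he he0 (by positivity)
      linarith
    calc
      exp (M * p j * (exp 1 - 1) - τ) ≤ exp (-(2 * log d)) := exp_le_exp.2 hexponent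
      _ = 1 / (d : ℝ) ^ 2 := by
        rw [exp_neg, one_div, two_mul, exp_add, exp_log hd0, sq]
  calc
    _ = P (⋃ j, {ω | τ < (v j ω : ℝ)}) := by rw [Set.ofPred_exists]
    _ ≤ ∑ j, P {ω | τ < (v j ω : ℝ)} := measure_iUnion_fintype_le _ _
    _ ≤ ∑ _j : Fin J, ENNReal.ofReal (1 / (d : ℝ) ^ 2) := Finset.sum_le_sum fun j _ => htail j
    _ = ENNReal.ofReal (J * (1 / (d : ℝ) ^ 2)) := by
      rw [ENNReal.ofReal_mul (Nat.cast_nonneg J)]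
      simp
    _ ≤ ENNReal.ofReal (1 / (d : ℝ)) := by
      refine ENNReal.ofReal_le_ofReal ?_
      have hJ' : (J : ℝ) ≤ d := by exact_mod_cast hJ
      calc
        (J : ℝ) * (1 / (d : ℝ) ^ 2) ≤ d * (1 / (d : ℝ) ^ 2) := by gcongr
        _ = 1 / (d : ℝ) := by field_simp
end

section
/- Let d ≥ 2 be a natural number and let 0 < r < 1. Let Z₀, Z₁, …, Z_{d−1} be independent standard Gaussian N(0,1) random variables. Then Pr[ √(2r·log d) + Z₀ > max_{1≤j≤d−1} Z_j ] ≥ e^{−1} · ( (1−√r)·√(2·log d) ) / ( √(2π)·( 2(1−√r)²·log d + 1 ) ) · d^{−(1−√r)²}. -/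
open MeasureTheory ProbabilityTheory Real

open Filter Topology in
/-- The lower Mills ratio bound for the standard Gaussian tail. -/
theorem gaussianReal_Ioi_ge (x : ℝ) :
    ENNReal.ofReal (x / (x ^ 2 + 1) * gaussianPDFReal 0 1 x) ≤ gaussianReal 0 1 (Set.Ioi x) := by
  rw [gaussianReal_apply_eq_integral 0 one_ne_zero]
  refine ENNReal.ofReal_le_ofReal ?_
  have hderiv (y : ℝ) : HasDerivAt (fun y => -(y / (y ^ 2 + 1) * gaussianPDFReal 0 1 y))
      ((1 - 2 / (y ^ 2 + 1) ^ 2) * gaussianPDFReal 0 1 y) y := by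
    have hy : y ^ 2 + 1 ≠ 0 := by positivity
    have hpdf : HasDerivAt (gaussianPDFReal 0 1) (-y * gaussianPDFReal 0 1 y) y := by
      refine (((((hasDerivAt_id y).sub_const 0).pow 2).neg.div_const
        (2 * ((1 : NNReal) : ℝ))).exp.const_mul (√(2 * π * (1 : NNReal)))⁻¹).congr_deriv ?_
      simp [gaussianPDFReal_def]
      ring
    refine (((hasDerivAt_id y).div (((hasDerivAt_id y).pow 2).add_const 1) hy).mul
      hpdf).neg.congr_deriv ?_
    simp
    field_simp
    ring
  have hbound (y : ℝ) : |1 - 2 / (y ^ 2 + 1) ^ 2| ≤ 1 := by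
    have h1 : 2 / (y ^ 2 + 1) ^ 2 ≤ 2 := div_le_self (by norm_num) (by nlinarith [sq_nonneg y])
    have h2 : 0 ≤ 2 / (y ^ 2 + 1) ^ 2 := by positivity
    rw [abs_le]
    constructor <;> linarith
  have hderiv_int : Integrable (fun y => (1 - 2 / (y ^ 2 + 1) ^ 2) * gaussianPDFReal 0 1 y) :=
    (integrable_gaussianPDFReal 0 1).bdd_mul (c := 1)
      (by fun_prop : Measurable fun y : ℝ => 1 - 2 / (y ^ 2 + 1) ^ 2).aestronglyMeasurable
      (ae_of_all _ hbound)
  have hpdf_lim : Tendsto (gaussianPDFReal 0 1) atTop (𝓝 0) := by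
    have hexp : Tendsto (fun y : ℝ => exp (-(y ^ 2 / 2))) atTop (𝓝 0) :=
      tendsto_exp_neg_atTop_nhds_zero.comp
        ((tendsto_pow_atTop two_ne_zero).atTop_div_const two_pos)
    simpa [gaussianPDFReal_def, neg_div] using hexp.const_mul (√(2 * π * (1 : NNReal)))⁻¹
  have hlim : Tendsto (fun y => -(y / (y ^ 2 + 1) * gaussianPDFReal 0 1 y)) atTop (𝓝 0) := by
    refine squeeze_zero_norm (fun y => ?_) hpdf_lim
    rw [norm_neg, norm_mul, Real.norm_eq_abs, Real.norm_eq_abs,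
      abs_of_nonneg (gaussianPDFReal_nonneg 0 1 y)]
    refine mul_le_of_le_one_left (gaussianPDFReal_nonneg 0 1 y) ?_
    rw [abs_div, abs_of_pos (by positivity : 0 < y ^ 2 + 1), div_le_one (by positivity)]
    nlinarith [sq_abs y, sq_nonneg (|y| - 1)]
  calc x / (x ^ 2 + 1) * gaussianPDFReal 0 1 x
      = ∫ y in Set.Ioi x, (1 - 2 / (y ^ 2 + 1) ^ 2) * gaussianPDFReal 0 1 y := by
        rw [integral_Ioi_of_hasDerivAt_of_tendsto' (fun y _ => hderiv y) hderiv_int.integrableOn hlim]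
        ring
    _ ≤ ∫ y in Set.Ioi x, gaussianPDFReal 0 1 y := by
        refine setIntegral_mono hderiv_int.integrableOn
          (integrable_gaussianPDFReal 0 1).integrableOn fun y => ?_
        exact mul_le_of_le_one_left (gaussianPDFReal_nonneg 0 1 y)
          ((le_abs_self _).trans (hbound y))

/-- The Chernoff bound for the standard Gaussian. -/
theorem gaussianReal_Iio_ge {t : ℝ} (ht : 0 ≤ t) :
    ENNReal.ofReal (1 - exp (-t ^ 2 / 2)) ≤ gaussianReal 0 1 (Set.Iio t) := by
  have hsub : HasSubgaussianMGF id 1 (gaussianReal 0 1) :=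
    { integrable_exp_mul := fun s => integrable_exp_mul_gaussianReal s
      mgf_le := fun s => by simp [mgf_id_gaussianReal] }
  have htail : (gaussianReal 0 1).real (Set.Ici t) ≤ exp (-t ^ 2 / 2) := by
    simpa [Set.Ici_def] using hsub.measure_ge_le ht
  have hcompl := probReal_compl_eq_one_sub (μ := gaussianReal 0 1) (measurableSet_Ici (a := t))
  rw [Set.compl_Ici] at hcompl
  rw [← ofReal_measureReal (μ := gaussianReal 0 1), hcompl]
  exact ENNReal.ofReal_le_ofReal (by linarith)

theorem exp_neg_one_le_one_sub_inv_pow {d : ℕ} (hd : 1 ≤ d) :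
    exp (-1) ≤ (1 - (d : ℝ)⁻¹) ^ (d - 1) := by
  obtain ⟨n, rfl⟩ := Nat.exists_eq_add_of_le' hd
  rcases Nat.eq_zero_or_pos n with rfl | hn
  · simp
  have hn' : (0 : ℝ) < n := by exact_mod_cast hn
  have heq : 1 - ((n + 1 : ℕ) : ℝ)⁻¹ = (1 + (n : ℝ)⁻¹)⁻¹ := by
    push_cast
    field_simp
    ring
  rw [heq, Nat.add_sub_cancel, inv_pow, exp_neg]
  exact inv_anti₀ (by positivity) one_add_inv_pow_le_exp

/-- A product of identical probability measures gives a box with one distinguished side `A` and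
all other sides `B` the expected mass. -/
theorem pi_box_distinguished {ι : Type*} [Fintype ι] [DecidableEq ι] {α : Type*}
    [MeasurableSpace α] (μ : Measure α) [SigmaFinite μ] (i : ι) (A B : Set α) :
    (Measure.pi fun _ : ι => μ) (Set.univ.pi fun j => if j = i then A else B) =
      μ A * μ B ^ (Fintype.card ι - 1) := by
  rw [Measure.pi_pi, ← Finset.mul_prod_erase _ _ (Finset.mem_univ i), if_pos rfl]
  congr 1
  rw [Finset.prod_congr rfl (g := fun _ => μ B) fun j hj => by
    rw [if_neg (Finset.ne_of_mem_erase hj)]]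
  simp

/-- For `d ≥ 2`, `0 < r < 1` and `Z₀,…,Z_{d−1}` i.i.d. standard Gaussians,
`Pr[√(2r log d) + Z₀ > max_{1≤j≤d−1} Z_j]` is at least
`e⁻¹ · (1−√r)√(2 log d) / (√(2π)(2(1−√r)² log d + 1)) · d^{−(1−√r)²}`. -/
theorem top1_support_prob_lower
    (d : ℕ) (hd : 2 ≤ d) (r : ℝ) (hr0 : 0 < r) (hr1 : r < 1) :
    (Measure.pi fun _ : Fin d => gaussianReal 0 1)
      {z | ∀ j : Fin d, j ≠ ⟨0, by omega⟩ →
            z j < Real.sqrt (2 * r * Real.log d) + z ⟨0, by omega⟩}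
      ≥ ENNReal.ofReal
          (Real.exp (-1) * ((1 - Real.sqrt r) * Real.sqrt (2 * Real.log d)) /
              (Real.sqrt (2 * Real.pi) * (2 * (1 - Real.sqrt r) ^ 2 * Real.log d + 1)) *
            (d : ℝ) ^ (-(1 - Real.sqrt r) ^ 2)) := by
  have hd0 : (0 : ℝ) < d := by exact_mod_cast (by omega : 0 < d)
  have hlog : 0 ≤ log d := log_nonneg (by exact_mod_cast (by omega : 1 ≤ d))
  have hsq : √(2 * log d) ^ 2 = 2 * log d := sq_sqrt (by positivity)
  set t := √(2 * log d) with ht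
  set x := (1 - √r) * t with hx
  have hshift : √(2 * r * log d) = t - x := by
    rw [show 2 * r * log d = r * (2 * log d) by ring, sqrt_mul hr0.le]
    ring
  have hxsq : x ^ 2 = 2 * (1 - √r) ^ 2 * log d := by rw [hx, mul_pow, hsq]; ring
  have hpdf : gaussianPDFReal 0 1 x = (√(2 * π))⁻¹ * (d : ℝ) ^ (-(1 - √r) ^ 2) := by
    rw [gaussianPDFReal_def, rpow_def_of_pos hd0]
    simp only [sub_zero, NNReal.coe_one, mul_one]
    rw [hxsq]
    congr 2
    ring
  have hexp : exp (-t ^ 2 / 2) = (d : ℝ)⁻¹ := by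
    rw [hsq, ← exp_log hd0, ← exp_neg, log_exp]
    congr 1
    ring
  have hIio := gaussianReal_Iio_ge (sqrt_nonneg (2 * log d))
  rw [← ht, hexp] at hIio
  have hone : 0 ≤ 1 - (d : ℝ)⁻¹ :=
    sub_nonneg.2 (inv_le_one_of_one_le₀ (by exact_mod_cast (by omega : 1 ≤ d)))
  calc ENNReal.ofReal (exp (-1) * x / (√(2 * π) * (2 * (1 - √r) ^ 2 * log d + 1)) *
          (d : ℝ) ^ (-(1 - √r) ^ 2))
      = ENNReal.ofReal (x / (x ^ 2 + 1) * gaussianPDFReal 0 1 x) * ENNReal.ofReal (exp (-1)) := by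
        rw [← ENNReal.ofReal_mul' (exp_nonneg _), hpdf, ← hxsq]
        congr 1
        field_simp
    _ ≤ gaussianReal 0 1 (Set.Ioi x) * gaussianReal 0 1 (Set.Iio t) ^ (d - 1) := by
        refine mul_le_mul' (gaussianReal_Ioi_ge x) ?_
        calc ENNReal.ofReal (exp (-1)) ≤ ENNReal.ofReal ((1 - (d : ℝ)⁻¹) ^ (d - 1)) :=
              ENNReal.ofReal_le_ofReal (exp_neg_one_le_one_sub_inv_pow (by omega))
          _ = ENNReal.ofReal (1 - (d : ℝ)⁻¹) ^ (d - 1) := ENNReal.ofReal_pow hone _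
          _ ≤ _ := by gcongr
    _ = (Measure.pi fun _ : Fin d => gaussianReal 0 1)
          (Set.univ.pi fun j => if j = ⟨0, by omega⟩ then Set.Ioi x else Set.Iio t) := by
        rw [pi_box_distinguished, Fintype.card_fin]
    _ ≤ _ := by
        refine measure_mono fun z hz j hj => ?_
        have h0 := hz ⟨0, by omega⟩ (Set.mem_univ _)
        have hzj := hz j (Set.mem_univ _)
        simp only [if_true, if_neg hj, Set.mem_Ioi, Set.mem_Iio] at h0 hzj
        linarith
end

section
/- Fix natural numbers d, K, L with 1 ≤ K ≤ L < (d−K)/2 and a real 0 < r < 1. Define a = √(2·log((d−K)/(L−K+1))), b = a − √(2r·log(d−K)), and M_{K,L} = M_{K,L}(d,r) = ⌈ max{ 8, (4√(2π)·(b²+1)/b) · (d−K)^{ (√(1 − log(L−K+1)/log(d−K)) − √r)² } } · 8·log d ⌉ if b > 0, and M_{K,L} = ⌈ 64·log d ⌉ if b ≤ 0. Assume M_{K,L} ≤ (d−K)/L. Consider the distributed sparse normal means model with machines i = 1,…,M_{K,L}: machine i observes x_{i,j} = μ_j + ε_{i,j}, where the ε_{i,j} are i.i.d. standard Gaussian N(0,1),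 μ is supported on a set Ω ⊆ [d] with |Ω| = K, μ_j ≥ √(2r·log(d−K)) for j ∈ Ω, and μ_j = 0 for j ∉ Ω. For each coordinate j define the vote count v_j = #{ i : #{ k ≠ j : x_{i,k} > x_{i,j} } ≤ L−1 } (i.e., the number of machines at which coordinate j is among the L largest observed coordinates). Then with probability at least 1 − K·d^{−1} − e³·d^{−3}, every k ∈ Ω satisfies v_k ≥ 4·log d and every j ∉ Ω satisfies v_j ≤ 4·log d. -/
open MeasureTheory ProbabilityTheory Real
open scoped Classical ENNReal

theorem pi_map_uncurry {ι κ : Type*} [Fintype ι] [Fintype κ] (ρ : Measure ℝ)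
    [IsProbabilityMeasure ρ] :
    (Measure.pi fun _ : ι => Measure.pi fun _ : κ => ρ).map
      (fun w (p : ι × κ) => w p.1 p.2) = Measure.pi fun _ : ι × κ => ρ := by
  refine (Measure.pi_eq fun s hs => ?_).symm
  have hpre : (fun (w : ι → κ → ℝ) (p : ι × κ) => w p.1 p.2) ⁻¹' Set.univ.pi s =
      Set.univ.pi fun i => Set.univ.pi fun j => s (i, j) := by
    ext w
    simp [Set.mem_pi]
  rw [Measure.map_apply (by fun_prop) (MeasurableSet.univ_pi hs), hpre]
  simp only [Measure.pi_pi, Fintype.prod_prod_type]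

section Chernoff

variable {α : Type*} [MeasurableSpace α] (ν : Measure α) [IsProbabilityMeasure ν]

theorem measurable_card_filter_mem {V : Set α} (hV : MeasurableSet V) (m : ℕ) :
    Measurable fun w : Fin m → α => ((Finset.univ.filter fun i => w i ∈ V).card : ℝ) := by
  simp only [Finset.card_filter, Nat.cast_sum]
  refine Finset.measurable_sum _ fun i _ => ?_
  have : Measurable fun x : α => (((if x ∈ V then 1 else 0 : ℕ)) : ℝ) :=
    measurable_from_top.comp (Measurable.ite hV measurable_const measurable_const)
  exact this.comp (measurable_pi_apply i)

theorem integrable_exp_mul_card_filter_mem {V : Set α} (hV : MeasurableSet V) (m : ℕ) (t : ℝ) :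
    Integrable (fun w : Fin m → α =>
      exp (t * ((Finset.univ.filter fun i => w i ∈ V).card : ℝ))) (Measure.pi fun _ => ν) := by
  refine Integrable.of_bound
    (((measurable_card_filter_mem hV m).const_mul t).exp.aestronglyMeasurable) (exp (|t| * m))
    (Filter.Eventually.of_forall fun w => ?_)
  rw [norm_of_nonneg (exp_pos _).le, exp_le_exp]
  refine (le_abs_self _).trans ?_
  rw [abs_mul, Nat.abs_cast]
  gcongr
  simpa using Finset.card_le_univ (Finset.univ.filter fun i => w i ∈ V)

theorem mgf_card_filter_mem_le {V : Set α} (hV : MeasurableSet V) (m : ℕ) (t : ℝ) :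
    mgf (fun w : Fin m → α => ((Finset.univ.filter fun i => w i ∈ V).card : ℝ))
      (Measure.pi fun _ => ν) t ≤ exp (m * ν.real V * (exp t - 1)) := by
  have hfac : ∀ w : Fin m → α, exp (t * ((Finset.univ.filter fun i => w i ∈ V).card : ℝ)) =
      ∏ i, (1 + V.indicator (fun _ => exp t - 1) (w i)) := fun w => by
    rw [Finset.card_filter, Nat.cast_sum, Finset.mul_sum, exp_sum]
    refine Finset.prod_congr rfl fun i _ => ?_
    by_cases h : w i ∈ V <;> simp [h]
  have hint : Integrable (V.indicator fun _ => exp t - 1) ν :=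
    (integrable_const _).indicator hV
  simp only [mgf, hfac]
  rw [integral_fintype_prod_eq_prod (fun _ (x : α) => 1 + V.indicator (fun _ => exp t - 1) x),
    integral_add (integrable_const _) hint, integral_indicator_const _ hV]
  simp only [integral_const, probReal_univ, smul_eq_mul, mul_one, Finset.prod_const,
    Finset.card_univ, Fintype.card_fin]
  rw [mul_assoc, exp_nat_mul]
  refine pow_le_pow_left₀ ?_ (by linarith [add_one_le_exp (ν.real V * (exp t - 1))]) m
  nlinarith [exp_pos t, measureReal_le_one (μ := ν) (s := V), measureReal_nonneg (μ := ν) (s := V)]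

theorem measureReal_ge_card_filter_mem_le {V : Set α} (hV : MeasurableSet V) (m : ℕ) (c : ℝ) :
    (Measure.pi fun _ : Fin m => ν).real
      {w | c ≤ ((Finset.univ.filter fun i => w i ∈ V).card : ℝ)} ≤
      exp (-c + m * ν.real V * (exp 1 - 1)) := by
  refine (measure_ge_le_exp_mul_mgf c zero_le_one
    (integrable_exp_mul_card_filter_mem ν hV m 1)).trans ?_
  rw [exp_add, neg_one_mul]
  gcongr
  exact mgf_card_filter_mem_le ν hV m 1

theorem measureReal_card_filter_mem_le_le {V : Set α} (hV : MeasurableSet V) (m : ℕ) (c : ℝ) :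
    (Measure.pi fun _ : Fin m => ν).real
      {w | ((Finset.univ.filter fun i => w i ∈ V).card : ℝ) ≤ c} ≤
      exp (c - m * ν.real V * (1 - exp (-1))) := by
  refine (measure_le_le_exp_mul_mgf c (by norm_num)
    (integrable_exp_mul_card_filter_mem ν hV m (-1))).trans ?_
  have := mgf_card_filter_mem_le ν hV m (-1)
  rw [sub_eq_add_neg, exp_add, neg_neg, one_mul, ← mul_neg, neg_sub]
  gcongr

end Chernoff

theorem gaussianReal_real_Ioi (c : ℝ) :
    (gaussianReal 0 1).real (Set.Ioi c) = (√(2 * π))⁻¹ * ∫ x in Set.Ioi c, exp (-x ^ 2 / 2) := by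
  rw [Measure.real, gaussianReal_apply_eq_integral _ one_ne_zero, ENNReal.toReal_ofReal,
    ← integral_const_mul]
  · simp [gaussianPDFReal]
  · exact setIntegral_nonneg measurableSet_Ioi fun x _ => gaussianPDFReal_nonneg _ _ _

theorem integrable_exp_neg_sq_half : Integrable fun x : ℝ => exp (-x ^ 2 / 2) := by
  refine (integrable_exp_neg_mul_sq (b := 1 / 2) (by norm_num)).congr
    (Filter.Eventually.of_forall fun x => ?_)
  simp only
  ring_nf

theorem gaussianReal_real_Ioi_zero : (gaussianReal 0 1).real (Set.Ioi 0) = 1 / 2 := by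
  have h := integral_gaussian_Ioi (1 / 2)
  have h2 : ∀ x : ℝ, -x ^ 2 / 2 = -(1 / 2) * x ^ 2 := fun x => by ring
  simp only [gaussianReal_real_Ioi, h2]
  rw [h, show π / (1 / 2) = 2 * π by ring]
  have : √(2 * π) ≠ 0 := by positivity
  field_simp

theorem gaussianReal_real_Ioi_le {c : ℝ} (hc : 0 ≤ c) :
    (gaussianReal 0 1).real (Set.Ioi c) ≤ exp (-c ^ 2 / 2) / 2 := by
  have h0 := gaussianReal_real_Ioi_zero
  rw [gaussianReal_real_Ioi] at h0 ⊢
  have hshift : ∫ x in Set.Ioi c, exp (-x ^ 2 / 2) = ∫ x in Set.Ioi 0, exp (-(x + c) ^ 2 / 2) := by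
    have := (measurePreserving_add_right volume c).setIntegral_preimage_emb
      (MeasurableEquiv.addRight c).measurableEmbedding (fun x => exp (-x ^ 2 / 2)) (Set.Ioi c)
    simpa using this.symm
  have hle : ∫ x in Set.Ioi c, exp (-x ^ 2 / 2) ≤
      exp (-c ^ 2 / 2) * ∫ x in Set.Ioi 0, exp (-x ^ 2 / 2) := by
    rw [hshift, ← integral_const_mul]
    refine setIntegral_mono_on (integrable_exp_neg_sq_half.comp_add_right c).integrableOn
      (integrable_exp_neg_sq_half.const_mul _).integrableOn measurableSet_Ioi fun x hx => ?_
    rw [← exp_add, exp_le_exp]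
    nlinarith [mul_nonneg (le_of_lt (Set.mem_Ioi.1 hx)) hc]
  calc _ ≤ (√(2 * π))⁻¹ * (exp (-c ^ 2 / 2) * ∫ x in Set.Ioi 0, exp (-x ^ 2 / 2)) := by gcongr
    _ = exp (-c ^ 2 / 2) * ((√(2 * π))⁻¹ * ∫ x in Set.Ioi 0, exp (-x ^ 2 / 2)) := by ring
    _ = _ := by rw [h0]; ring

theorem half_le_gaussianReal_real_Ioi {c : ℝ} (hc : c ≤ 0) :
    1 / 2 ≤ (gaussianReal 0 1).real (Set.Ioi c) :=
  gaussianReal_real_Ioi_zero.symm.le.trans (measureReal_mono (Set.Ioi_subset_Ioi hc))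

theorem le_gaussianReal_real_Ioi {c : ℝ} (hc : 0 < c) :
    c / (c ^ 2 + 1) * exp (-c ^ 2 / 2) / √(2 * π) ≤ (gaussianReal 0 1).real (Set.Ioi c) := by
  have hderiv : ∀ x ∈ Set.Ici c, HasDerivAt (fun x : ℝ => -(exp (-x ^ 2 / 2) / x))
      ((1 + 1 / x ^ 2) * exp (-x ^ 2 / 2)) x := fun x hx => by
    have hx0 : x ≠ 0 := (hc.trans_le hx).ne'
    have h1 : HasDerivAt (fun x : ℝ => -x ^ 2 / 2) (-x) x := by
      exact ((hasDerivAt_pow 2 x).neg.div_const 2).congr_deriv (by simp; ring)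
    refine (h1.exp.div (hasDerivAt_id x) hx0).neg.congr_deriv ?_
    simp only [id]
    field_simp
    ring
  have htend : Filter.Tendsto (fun x : ℝ => -(exp (-x ^ 2 / 2) / x)) Filter.atTop (nhds 0) := by
    rw [← neg_zero]
    refine Filter.Tendsto.neg (squeeze_zero' ?_ ?_ tendsto_inv_atTop_zero)
    · filter_upwards [Filter.eventually_gt_atTop 0] with x hx
      positivity
    · filter_upwards [Filter.eventually_gt_atTop 0] with x hx
      rw [div_eq_mul_inv]
      refine mul_le_of_le_one_left (by positivity) (exp_le_one_iff.2 ?_)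
      nlinarith [sq_nonneg x]
  have hnn : ∀ x ∈ Set.Ioi c, 0 ≤ (1 + 1 / x ^ 2) * exp (-x ^ 2 / 2) := fun x _ => by positivity
  have hint := integrableOn_Ioi_deriv_of_nonneg' hderiv hnn htend
  have hval := integral_Ioi_of_hasDerivAt_of_tendsto' hderiv hint htend
  have hle : ∫ x in Set.Ioi c, (1 + 1 / x ^ 2) * exp (-x ^ 2 / 2) ≤
      (1 + 1 / c ^ 2) * ∫ x in Set.Ioi c, exp (-x ^ 2 / 2) := by
    rw [← integral_const_mul]
    refine setIntegral_mono_on hint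
      (integrable_exp_neg_sq_half.const_mul _).integrableOn measurableSet_Ioi fun x hx => ?_
    have : c ≤ x := le_of_lt hx
    gcongr
  rw [hval] at hle
  rw [gaussianReal_real_Ioi, div_eq_inv_mul]
  refine mul_le_mul_of_nonneg_left ?_ (by positivity)
  have hI : exp (-c ^ 2 / 2) / c ≤ (1 + 1 / c ^ 2) * ∫ x in Set.Ioi c, exp (-x ^ 2 / 2) := by
    linarith
  calc c / (c ^ 2 + 1) * exp (-c ^ 2 / 2) = (c ^ 2 / (c ^ 2 + 1)) * (exp (-c ^ 2 / 2) / c) := by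
        field_simp
    _ ≤ (c ^ 2 / (c ^ 2 + 1)) * ((1 + 1 / c ^ 2) * ∫ x in Set.Ioi c, exp (-x ^ 2 / 2)) := by gcongr
    _ = _ := by field_simp

section Vote

variable {d : ℕ}

/-- The noise vectors for which a machine running Top-`L` on mean `μ` votes for coordinate `j`. -/
def voteSet (μ : Fin d → ℝ) (L : ℕ) (j : Fin d) : Set (Fin d → ℝ) :=
  {x | (Finset.univ.filter fun k' : Fin d => k' ≠ j ∧ μ j + x j < μ k' + x k').card ≤ L - 1}

theorem measurableSet_voteSet (μ : Fin d → ℝ) (L : ℕ) (j : Fin d) :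
    MeasurableSet (voteSet μ L j) := by
  have hm : Measurable fun x : Fin d → ℝ =>
      (Finset.univ.filter fun k' : Fin d => k' ≠ j ∧ μ j + x j < μ k' + x k').card := by
    simp only [Finset.card_filter]
    refine Finset.measurable_sum _ fun k' _ => Measurable.ite ?_ measurable_const measurable_const
    exact (MeasurableSet.const _).inter (measurableSet_lt
      (f := fun x : Fin d → ℝ => μ j + x j) (g := fun x => μ k' + x k')
      (by fun_prop) (by fun_prop))
  exact measurableSet_le hm measurable_const

theorem card_filter_rank_le {y : Fin d → ℝ} (hy : Function.Injective y) {L : ℕ} (hL : 1 ≤ L) :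
    (Finset.univ.filter fun j =>
      (Finset.univ.filter fun k => k ≠ j ∧ y j < y k).card ≤ L - 1).card ≤ L := by
  have hlt : ∀ i j, y i < y j → (Finset.univ.filter fun k => k ≠ j ∧ y j < y k).card <
      (Finset.univ.filter fun k => k ≠ i ∧ y i < y k).card := fun i j hij => by
    refine Finset.card_lt_card (Finset.ssubset_iff_of_subset ?_ |>.2 ⟨j, ?_, ?_⟩)
    · intro k hk
      simp only [Finset.mem_filter, Finset.mem_univ, true_and] at hk ⊢
      refine ⟨?_, hij.trans hk.2⟩
      rintro rfl
      exact lt_asymm hij hk.2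
    · simp only [Finset.mem_filter, Finset.mem_univ, true_and]
      refine ⟨?_, hij⟩
      rintro rfl
      exact lt_irrefl _ hij
    · simp
  calc _ ≤ (Finset.range L).card := by
        refine Finset.card_le_card_of_injOn
          (fun j => (Finset.univ.filter fun k => k ≠ j ∧ y j < y k).card) ?_ ?_
        · intro j hj
          simp only [Finset.coe_filter, Finset.mem_univ, true_and, Set.mem_ofPred_eq] at hj
          simp only [Finset.coe_range, Set.mem_Iio]
          omega
        · intro i _ j _ hij
          by_contra hne
          rcases lt_or_gt_of_ne (hy.ne hne) with h | h
          · exact (hlt _ _ h).ne' hij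
          · exact (hlt _ _ h).ne hij
    _ = L := Finset.card_range L

theorem measurable_comp_perm (e : Equiv.Perm (Fin d)) : Measurable fun x : Fin d → ℝ => x ∘ e :=
  measurable_pi_lambda _ fun i => measurable_pi_apply (e i)

theorem pi_map_comp_perm (ρ : Measure ℝ) [IsProbabilityMeasure ρ] (e : Equiv.Perm (Fin d)) :
    (Measure.pi fun _ : Fin d => ρ).map (fun x => x ∘ e) = Measure.pi fun _ : Fin d => ρ := by
  refine (Measure.pi_eq fun s hs => ?_).symm
  have hpre : (fun x : Fin d → ℝ => x ∘ e) ⁻¹' Set.univ.pi s =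
      Set.univ.pi fun i => s (e.symm i) := by
    ext x
    simp only [Set.mem_preimage, Set.mem_pi, Set.mem_univ, true_imp_iff, Function.comp_apply]
    exact ⟨fun h i => by simpa using h (e.symm i), fun h i => by simpa using h (e i)⟩
  rw [Measure.map_apply (measurable_comp_perm _)
    (MeasurableSet.univ_pi hs), hpre, Measure.pi_pi]
  exact Equiv.prod_comp e.symm fun i => ρ (s i)

theorem measure_voteSet_eq (ρ : Measure ℝ) [IsProbabilityMeasure ρ] {μ : Fin d → ℝ} (L : ℕ)
    {i j : Fin d} (h : μ i = μ j) :
    (Measure.pi fun _ : Fin d => ρ) (voteSet μ L i) =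
      (Measure.pi fun _ : Fin d => ρ) (voteSet μ L j) := by
  have hμ : ∀ k, μ (Equiv.swap i j k) = μ k := fun k => by
    rw [Equiv.swap_apply_def]
    split_ifs with h1 h2
    · rw [h1, h]
    · rw [h2, h]
    · rfl
  conv_lhs => rw [← pi_map_comp_perm ρ (Equiv.swap i j)]
  rw [Measure.map_apply (measurable_comp_perm _)
    (measurableSet_voteSet μ L i)]
  congr 1
  ext x
  simp only [voteSet, Set.mem_preimage, Set.mem_ofPred_eq, Function.comp_apply]
  rw [Finset.card_equiv (Equiv.swap i j) fun k => ?_]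
  simp only [Finset.mem_filter, Finset.mem_univ, true_and, hμ, Equiv.swap_apply_left, h]
  have hk : Equiv.swap i j k = j ↔ k = i := by rw [Equiv.swap_apply_eq_iff, Equiv.swap_apply_right]
  rw [Ne, Ne, hk]

theorem ae_injective_add_gaussian (μ : Fin d → ℝ) :
    ∀ᵐ x ∂(Measure.pi fun _ : Fin d => gaussianReal 0 1),
      Function.Injective fun j => μ j + x j := by
  have key : ∀ i j : Fin d, ∀ᵐ x ∂(Measure.pi fun _ : Fin d => gaussianReal 0 1),
      μ i + x i = μ j + x j → i = j := fun i j => by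
    by_cases hij : i = j
    · exact Filter.Eventually.of_forall fun _ _ => hij
    have hind := (iIndepFun_pi (μ := fun _ : Fin d => gaussianReal 0 1) (X := fun _ x => x)
      fun _ => aemeasurable_id).indepFun hij
    have hlaw : ∀ k : Fin d, (Measure.pi fun _ : Fin d => gaussianReal 0 1).map
        (fun x => x k) = gaussianReal 0 1 := fun k => (measurePreserving_eval _ k).map_eq
    have hneg : (Measure.pi fun _ : Fin d => gaussianReal 0 1).map
        (fun x => -x j) = gaussianReal 0 1 := by
      have := gaussianReal_map_neg (μ := 0) (v := 1)
      rwa [neg_zero, ← hlaw j, Measure.map_map (g := fun x : ℝ => -x) measurable_neg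
        (measurable_pi_apply j), hlaw j] at this
    have hsum := gaussianReal_add_gaussianReal_of_indepFun
      (hind.comp measurable_id measurable_neg) (hlaw i) hneg
    have := nullSingletonClass_gaussianReal (μ := 0 + 0) (v := 1 + 1) (by norm_num)
    have hnull : gaussianReal (0 + 0) (1 + 1) {μ j - μ i} = 0 := measure_singleton _
    rw [← hsum, Measure.map_apply (by fun_prop) (measurableSet_singleton _)] at hnull
    rw [ae_iff]
    refine measure_mono_null (fun x hx => ?_) hnull
    simp only [Set.mem_ofPred_eq, Classical.not_imp] at hx
    simp only [Set.mem_preimage, Pi.add_apply, Function.comp_apply, id, Set.mem_singleton_iff]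
    linarith [hx.1]
  filter_upwards [ae_all_iff.2 fun i => ae_all_iff.2 (key i)] with x hx i j hij using hx i j hij

theorem card_mul_measureReal_voteSet_le {μ : Fin d → ℝ} {L : ℕ} (hL : 1 ≤ L) {S : Finset (Fin d)}
    (hμ0 : ∀ j ∉ S, μ j = 0) {j : Fin d} (hj : j ∉ S) :
    (Sᶜ.card : ℝ) * (Measure.pi fun _ : Fin d => gaussianReal 0 1).real (voteSet μ L j) ≤ L := by
  set ν : Measure (Fin d → ℝ) := Measure.pi fun _ : Fin d => gaussianReal 0 1
  have hint : ∀ i ∈ Sᶜ, Integrable ((voteSet μ L i).indicator fun _ => (1 : ℝ)) ν := fun i _ =>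
    (integrable_const _).indicator (measurableSet_voteSet μ L i)
  have hsum : ∫ x, ∑ i ∈ Sᶜ, (voteSet μ L i).indicator (fun _ => (1 : ℝ)) x ∂ν =
      Sᶜ.card * ν.real (voteSet μ L j) := by
    rw [integral_finsetSum _ hint, ← nsmul_eq_mul]
    refine Finset.sum_eq_card_nsmul fun i hi => ?_
    rw [integral_indicator_const _ (measurableSet_voteSet μ L i), smul_eq_mul, mul_one,
      Measure.real, measure_voteSet_eq _ L
        ((hμ0 i (Finset.mem_compl.1 hi)).trans (hμ0 j hj).symm)]
    rfl
  rw [← hsum]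
  calc _ ≤ ∫ _, (L : ℝ) ∂ν := by
        refine integral_mono_ae (integrable_finsetSum _ hint) (integrable_const _) ?_
        filter_upwards [ae_injective_add_gaussian μ] with x hx
        simp only [Set.indicator_apply, Finset.sum_boole]
        exact_mod_cast (Finset.card_le_card fun i hi => by
          simpa [voteSet] using (Finset.mem_filter.1 hi).2).trans (card_filter_rank_le hx hL)
    _ = L := by simp

theorem half_mul_le_measureReal_voteSet {μ : Fin d → ℝ} {L : ℕ} {S : Finset (Fin d)}
    (hSL : S.card ≤ L) (hμ0 : ∀ j ∉ S, μ j = 0) {k : Fin d} (hk : k ∈ S) {a : ℝ}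
    (ha : (Sᶜ.card : ℝ) * (gaussianReal 0 1).real (Set.Ioi a) ≤ ((L : ℝ) - S.card + 1) / 2) :
    (gaussianReal 0 1).real (Set.Ioi (a - μ k)) / 2 ≤
      (Measure.pi fun _ : Fin d => gaussianReal 0 1).real (voteSet μ L k) := by
  set ν : Measure (Fin d → ℝ) := Measure.pi fun _ : Fin d => gaussianReal 0 1
  set N : (Fin d → ℝ) → ℝ := fun x => ∑ j ∈ Sᶜ, (Set.Ioi a).indicator (fun _ => (1 : ℝ)) (x j)
    with hN
  have hq : 0 < (L : ℝ) - S.card + 1 := by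
    have : (S.card : ℝ) ≤ L := by exact_mod_cast hSL
    linarith
  have hmeas1 : Measurable ((Set.Ioi a).indicator fun _ => (1 : ℝ)) :=
    measurable_const.indicator measurableSet_Ioi
  have hlaw : ∀ (j : Fin d) (c : ℝ),
      ν.real {x | c < x j} = (gaussianReal 0 1).real (Set.Ioi c) := fun j c =>
    (measurePreserving_eval (fun _ : Fin d => gaussianReal 0 1) j).measureReal_preimage
      measurableSet_Ioi.nullMeasurableSet
  have hint : ∀ j ∈ Sᶜ,
      Integrable (fun x : Fin d → ℝ => (Set.Ioi a).indicator (fun _ => (1 : ℝ)) (x j)) ν := fun j _ =>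
    (integrable_const (1 : ℝ)).indicator (s := {x : Fin d → ℝ | a < x j})
      (measurableSet_lt measurable_const (measurable_pi_apply j))
  have hEN : ∫ x, N x ∂ν = Sᶜ.card * (gaussianReal 0 1).real (Set.Ioi a) := by
    rw [hN, integral_finsetSum _ hint, ← nsmul_eq_mul]
    refine Finset.sum_eq_card_nsmul fun j _ => ?_
    have := integral_indicator_const (μ := ν) (1 : ℝ) (s := {x : Fin d → ℝ | a < x j})
      (measurableSet_lt measurable_const (measurable_pi_apply j))
    rw [smul_eq_mul, mul_one, hlaw] at this
    exact this
  have hNmeas : Measurable N :=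
    Finset.measurable_sum _ fun j _ => hmeas1.comp (measurable_pi_apply j)
  have hB : 1 / 2 ≤ ν.real (N ⁻¹' Set.Iio ((L : ℝ) - S.card + 1)) := by
    have hN0 : 0 ≤ᵐ[ν] N := Filter.Eventually.of_forall fun x => Finset.sum_nonneg fun j _ =>
      Set.indicator_nonneg (fun _ _ => zero_le_one) (x j)
    have hmarkov := mul_meas_ge_le_integral_of_nonneg hN0 (integrable_finsetSum Sᶜ hint)
      ((L : ℝ) - S.card + 1)
    have hcompl := probReal_compl_eq_one_sub (μ := ν)
      (hNmeas (measurableSet_Iio (a := (L : ℝ) - S.card + 1)))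
    have hset : (N ⁻¹' Set.Iio ((L : ℝ) - S.card + 1))ᶜ = {x | (L : ℝ) - S.card + 1 ≤ N x} := by
      ext x
      simp
    rw [hset] at hcompl
    have h2 : ((L : ℝ) - S.card + 1) * ν.real {x | (L : ℝ) - S.card + 1 ≤ N x} ≤
        ((L : ℝ) - S.card + 1) * (1 / 2) := by
      refine hmarkov.trans ?_
      rw [← hN, hEN]
      linarith
    linarith [le_of_mul_le_mul_left h2 hq]
  have hind : IndepFun (fun x : Fin d → ℝ => x k) N ν := by
    have h := (iIndepFun_pi (μ := fun _ : Fin d => gaussianReal 0 1) (X := fun _ x => x)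
      fun _ => aemeasurable_id).indepFun_finset {k} Sᶜ (by simpa using hk)
      fun i => measurable_pi_apply i
    have hφ : Measurable fun y : ({k} : Finset (Fin d)) → ℝ =>
        y ⟨k, Finset.mem_singleton_self k⟩ := measurable_pi_apply _
    have hψ : Measurable fun y : ↥(Sᶜ : Finset (Fin d)) → ℝ =>
        ∑ j, (Set.Ioi a).indicator (fun _ => (1 : ℝ)) (y j) :=
      Finset.measurable_sum _ fun j _ => hmeas1.comp (measurable_pi_apply j)
    have h2 := h.comp hφ hψ
    have hNψ : N = (fun y : ↥(Sᶜ : Finset (Fin d)) → ℝ =>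
        ∑ j, (Set.Ioi a).indicator (fun _ => (1 : ℝ)) (y j)) ∘ fun x i => x i := funext fun x =>
      (Finset.sum_coe_sort Sᶜ fun j => (Set.Ioi a).indicator (fun _ => (1 : ℝ)) (x j)).symm
    rw [hNψ]
    exact h2
  have hprod : ν.real ((fun x : Fin d → ℝ => x k) ⁻¹' Set.Ioi (a - μ k) ∩
      N ⁻¹' Set.Iio ((L : ℝ) - S.card + 1)) =
      (gaussianReal 0 1).real (Set.Ioi (a - μ k)) *
        ν.real (N ⁻¹' Set.Iio ((L : ℝ) - S.card + 1)) := by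
    rw [← hlaw k]
    simp only [Measure.real, ← ENNReal.toReal_mul]
    rw [hind.measure_inter_preimage_eq_mul _ _ measurableSet_Ioi measurableSet_Iio]
    rfl
  calc _ ≤ (gaussianReal 0 1).real (Set.Ioi (a - μ k)) *
        ν.real (N ⁻¹' Set.Iio ((L : ℝ) - S.card + 1)) := by
        nlinarith [measureReal_nonneg (μ := gaussianReal 0 1) (s := Set.Ioi (a - μ k))]
    _ ≤ _ := hprod.symm.le.trans (measureReal_mono ?_)
  rintro x ⟨hx1, hx2⟩
  simp only [Set.mem_preimage, Set.mem_Ioi, Set.mem_Iio] at hx1 hx2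
  have hcard : (Sᶜ.filter fun j => a < x j).card < L - S.card + 1 := by
    have : N x = ((Sᶜ.filter fun j => a < x j).card : ℝ) := by
      simp [hN, Set.indicator_apply]
    rw [this] at hx2
    rw [← Nat.cast_lt (α := ℝ)]
    push_cast [hSL]
    exact hx2
  have hsub : (Finset.univ.filter fun k' => k' ≠ k ∧ μ k + x k < μ k' + x k') ⊆
      S.erase k ∪ Sᶜ.filter fun j => a < x j := fun j hj => by
    simp only [Finset.mem_filter, Finset.mem_univ, true_and] at hj
    by_cases hjS : j ∈ S
    · exact Finset.mem_union_left _ (Finset.mem_erase.2 ⟨hj.1, hjS⟩)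
    · refine Finset.mem_union_right _ (Finset.mem_filter.2 ⟨Finset.mem_compl.2 hjS, ?_⟩)
      linarith [hj.2, hμ0 j hjS]
  have h3 := (Finset.card_le_card hsub).trans (Finset.card_union_le _ _)
  rw [Finset.card_erase_of_mem hk] at h3
  have hpos := Finset.card_pos.2 ⟨k, hk⟩
  change _ ≤ L - 1
  omega

end Vote

theorem rpow_sq_sqrt_sub_sqrt {n q r : ℝ} (hn : 1 < n) (hq : 0 < q) :
    n ^ ((√(1 - log q / log n) - √r) ^ 2) =
      exp ((√(2 * log (n / q)) - √(2 * r * log n)) ^ 2 / 2) := by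
  have hlog : 0 < log n := log_pos hn
  have h1 : 2 * log (n / q) = 2 * log n * (1 - log q / log n) := by
    rw [log_div (by positivity) hq.ne']
    field_simp
  have h2 : 2 * r * log n = 2 * log n * r := by ring
  rw [rpow_def_of_pos (by positivity), h1, h2,
    sqrt_mul (x := 2 * log n) (by positivity), sqrt_mul (x := 2 * log n) (by positivity),
    ← mul_sub, mul_pow, sq_sqrt (by positivity)]
  congr 1
  ring

theorem one_sub_le_measureReal_votes {d : ℕ} (hd : 0 < d) (ν : Measure (Fin d → ℝ))
    [IsProbabilityMeasure ν] {V : Fin d → Set (Fin d → ℝ)} (hV : ∀ j, MeasurableSet (V j))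
    (m : ℕ) (S : Finset (Fin d)) (hS : ∀ k ∈ S, 16 * log d ≤ m * ν.real (V k))
    (hSc : ∀ j ∉ S, m * ν.real (V j) ≤ 1) :
    1 - (S.card : ℝ) / d - exp 3 / (d : ℝ) ^ 3 ≤ (Measure.pi fun _ : Fin m => ν).real
      {w | (∀ k ∈ S, 4 * log d ≤ ((Finset.univ.filter fun i => w i ∈ V k).card : ℝ)) ∧
        ∀ j ∉ S, ((Finset.univ.filter fun i => w i ∈ V j).card : ℝ) ≤ 4 * log d} := by
  set P := Measure.pi fun _ : Fin m => ν
  set G := {w : Fin m → Fin d → ℝ |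
    (∀ k ∈ S, 4 * log d ≤ ((Finset.univ.filter fun i => w i ∈ V k).card : ℝ)) ∧
      ∀ j ∉ S, ((Finset.univ.filter fun i => w i ∈ V j).card : ℝ) ≤ 4 * log d} with hG
  have hd0 : (0 : ℝ) < d := by exact_mod_cast hd
  have hlog : 0 ≤ log d := log_nonneg (by exact_mod_cast hd)
  have hlow : ∀ k ∈ S,
      P.real {w | ((Finset.univ.filter fun i => w i ∈ V k).card : ℝ) ≤ 4 * log d} ≤ 1 / d :=
    fun k hk => by
    refine (measureReal_card_filter_mem_le_le ν (hV k) m _).trans ?_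
    have he : exp (-1) ≤ 1 / 2 := by
      rw [exp_neg, one_div]
      exact inv_anti₀ two_pos (by linarith [add_one_le_exp (1 : ℝ)])
    rw [one_div, ← exp_log (inv_pos.2 hd0), log_inv, exp_le_exp]
    nlinarith [hS k hk]
  have hupp : ∀ j ∈ Sᶜ,
      P.real {w | 4 * log d ≤ ((Finset.univ.filter fun i => w i ∈ V j).card : ℝ)} ≤
        exp 3 / (d : ℝ) ^ 4 := fun j hj => by
    refine (measureReal_ge_card_filter_mem_le ν (hV j) m _).trans ?_
    have h4 : (d : ℝ) ^ 4 = exp (4 * log d) := by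
      rw [← exp_log hd0, ← exp_nat_mul, exp_log hd0]
      norm_num
    rw [h4, ← exp_sub, exp_le_exp]
    have h1 := hSc j (Finset.mem_compl.1 hj)
    nlinarith [exp_one_lt_three, add_one_le_exp (1 : ℝ)]
  have hcov : Gᶜ ⊆
      (⋃ k ∈ S, {w | ((Finset.univ.filter fun i => w i ∈ V k).card : ℝ) ≤ 4 * log d}) ∪
      ⋃ j ∈ Sᶜ, {w | 4 * log d ≤ ((Finset.univ.filter fun i => w i ∈ V j).card : ℝ)} := by
    intro w hw
    by_contra hcon
    simp only [Set.mem_union, Set.mem_iUnion, Set.mem_ofPred_eq, not_or, not_exists, not_le,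
      Finset.mem_compl] at hcon
    exact hw ⟨fun k hk => (hcon.1 k hk).le, fun j hj => (hcon.2 j hj).le⟩
  have hbad : P.real Gᶜ ≤ S.card * (1 / d) + d * (exp 3 / (d : ℝ) ^ 4) := by
    refine (measureReal_mono hcov).trans ((measureReal_union_le _ _).trans (add_le_add ?_ ?_))
    · refine (measureReal_biUnion_finset_le _ _).trans ((Finset.sum_le_sum hlow).trans ?_)
      simp
    · refine (measureReal_biUnion_finset_le _ _).trans ((Finset.sum_le_sum hupp).trans ?_)
      rw [Finset.sum_const, nsmul_eq_mul]
      gcongr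
      simpa using Finset.card_le_univ Sᶜ
  have htot : 1 ≤ P.real G + P.real Gᶜ := by
    rw [← probReal_univ (μ := P), ← Set.union_compl_self G]
    exact measureReal_union_le _ _
  have : (d : ℝ) * (exp 3 / (d : ℝ) ^ 4) = exp 3 / (d : ℝ) ^ 3 := by
    field_simp
  rw [this, mul_one_div] at hbad
  linarith

/-- Theorem 3.1b, Top-L algorithm: in the distributed sparse normal means
model with `M_{K,L}(d,r)` machines, a `K`-sparse mean with signal `≥ √(2r log(d−K))` on its
support `S`, and i.i.d. standard Gaussian noise, with probability at least
`1 − K d⁻¹ − e³ d⁻³` every support coordinate receives at least `4 log d` votes while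
every non-support coordinate receives at most `4 log d` votes, where machine `i` votes for
the `L` coordinates with the largest samples. -/
theorem topL_support_recovery
    (d K L : ℕ) (hK : 1 ≤ K) (hKL : K ≤ L) (hL : (L : ℝ) < ((d : ℝ) - K) / 2)
    (r : ℝ) (hr0 : 0 < r) (hr1 : r < 1)
    (a b : ℝ)
    (ha : a = Real.sqrt (2 * Real.log (((d : ℝ) - K) / ((L : ℝ) - K + 1))))
    (hb : b = a - Real.sqrt (2 * r * Real.log ((d : ℝ) - K)))
    (MKL : ℕ)
    (hMKL : MKL = if 0 < b then
        ⌈(max 8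
            (4 * Real.sqrt (2 * Real.pi) * (b ^ 2 + 1) / b *
              ((d : ℝ) - K) ^
                ((Real.sqrt (1 - Real.log ((L : ℝ) - K + 1) / Real.log ((d : ℝ) - K)) -
                    Real.sqrt r) ^ 2))) * (8 * Real.log d)⌉₊
      else ⌈64 * Real.log d⌉₊)
    (hMle : (MKL : ℝ) ≤ ((d : ℝ) - K) / L)
    (S : Finset (Fin d)) (hS : S.card = K)
    (μ : Fin d → ℝ)
    (hμS : ∀ k ∈ S, Real.sqrt (2 * r * Real.log ((d : ℝ) - K)) ≤ μ k)
    (hμ0 : ∀ j ∉ S, μ j = 0) :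
    (Measure.pi fun _ : Fin MKL × Fin d => gaussianReal 0 1)
      {ε | (∀ k ∈ S, 4 * Real.log d ≤
              ((Finset.univ.filter fun i : Fin MKL =>
                  (Finset.univ.filter fun k' : Fin d =>
                      k' ≠ k ∧ μ k + ε (i, k) < μ k' + ε (i, k')).card ≤ L - 1).card : ℝ))
           ∧ ∀ j ∉ S,
              ((Finset.univ.filter fun i : Fin MKL =>
                  (Finset.univ.filter fun k' : Fin d =>
                      k' ≠ j ∧ μ j + ε (i, j) < μ k' + ε (i, k')).card ≤ L - 1).card : ℝ)
                ≤ 4 * Real.log d}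
      ≥ ENNReal.ofReal (1 - (K : ℝ) / d - Real.exp 3 / (d : ℝ) ^ 3) := by
  have hL1 : (1 : ℝ) ≤ L := by exact_mod_cast hK.trans hKL
  have hKL' : (K : ℝ) ≤ L := by exact_mod_cast hKL
  have hK1 : (1 : ℝ) ≤ K := by exact_mod_cast hK
  have hd : 0 < d := by
    rw [← Nat.cast_pos (α := ℝ)]
    linarith
  have hSc : (Sᶜ.card : ℝ) = (d : ℝ) - K := by
    rw [Finset.card_compl, Fintype.card_fin, hS, Nat.cast_sub]
    simpa [hS] using Finset.card_le_univ S
  set n : ℝ := (d : ℝ) - K with hn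
  set q : ℝ := (L : ℝ) - K + 1 with hq
  have hq0 : 0 < q := by linarith
  have hn1 : 1 < n := by linarith
  have hn0 : 0 < n := by linarith
  have hlogd : 0 ≤ log d := log_nonneg (by exact_mod_cast hd)
  have ha0 : 0 ≤ a := ha ▸ sqrt_nonneg _
  have ha2 : exp (-a ^ 2 / 2) = q / n := by
    have hlog : 0 ≤ log (n / q) := log_nonneg ((one_le_div hq0).2 (by linarith))
    rw [ha, sq_sqrt (by positivity), neg_div, mul_div_cancel_left₀ _ two_ne_zero, ← log_inv,
      inv_div, exp_log (by positivity)]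
  have hexceed : n * (gaussianReal 0 1).real (Set.Ioi a) ≤ q / 2 := by
    have := mul_le_mul_of_nonneg_left (gaussianReal_real_Ioi_le ha0) hn0.le
    rw [ha2] at this
    refine this.trans (le_of_eq ?_)
    field_simp
  have htail : 32 * log d ≤ MKL * (gaussianReal 0 1).real (Set.Ioi b) := by
    split_ifs at hMKL with hb0
    · have hM := Nat.le_ceil ((max 8 (4 * √(2 * π) * (b ^ 2 + 1) / b *
        n ^ ((√(1 - log q / log n) - √r) ^ 2))) * (8 * log d))
      rw [← hMKL] at hM
      have hpow : n ^ ((√(1 - log q / log n) - √r) ^ 2) = exp (b ^ 2 / 2) := by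
        rw [rpow_sq_sqrt_sub_sqrt hn1 hq0, hb, ha]
      rw [hpow] at hM
      calc 32 * log d = 4 * √(2 * π) * (b ^ 2 + 1) / b * exp (b ^ 2 / 2) * (8 * log d) *
            (b / (b ^ 2 + 1) * exp (-b ^ 2 / 2) / √(2 * π)) := by
            rw [neg_div, exp_neg]
            field_simp
            ring
        _ ≤ MKL * (gaussianReal 0 1).real (Set.Ioi b) := by
            refine mul_le_mul (le_trans ?_ hM) (le_gaussianReal_real_Ioi hb0) (by positivity)
              (Nat.cast_nonneg _)
            gcongr
            exact le_max_right _ _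
    · have hM := Nat.le_ceil (64 * log d)
      rw [← hMKL] at hM
      have := half_le_gaussianReal_real_Ioi (not_lt.1 hb0)
      nlinarith
  set ν : Measure (Fin d → ℝ) := Measure.pi fun _ => gaussianReal 0 1
  have hlow : ∀ k ∈ S, 16 * log d ≤ MKL * ν.real (voteSet μ L k) := fun k hk => by
    have h1 := half_mul_le_measureReal_voteSet (hS ▸ hKL) hμ0 hk (a := a)
      (by rw [hSc, hS]; exact hexceed)
    have h2 : (gaussianReal 0 1).real (Set.Ioi b) ≤
        (gaussianReal 0 1).real (Set.Ioi (a - μ k)) :=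
      measureReal_mono (Set.Ioi_subset_Ioi (by linarith [hμS k hk]))
    have h3 : (MKL : ℝ) * ((gaussianReal 0 1).real (Set.Ioi b) / 2) ≤
        MKL * ν.real (voteSet μ L k) := by
      gcongr
      linarith
    linarith
  have hupp : ∀ j ∉ S, MKL * ν.real (voteSet μ L j) ≤ 1 := fun j hj => by
    have h1 := card_mul_measureReal_voteSet_le (hK.trans hKL) hμ0 hj
    rw [hSc] at h1
    calc (MKL : ℝ) * ν.real (voteSet μ L j) ≤ n / L * ν.real (voteSet μ L j) := by gcongr
      _ = n * ν.real (voteSet μ L j) / L := by ring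
      _ ≤ 1 := (div_le_one (by linarith)).2 h1
  have hmain := one_sub_le_measureReal_votes hd ν (measurableSet_voteSet μ L) MKL S hlow hupp
  rw [ge_iff_le, ← pi_map_uncurry]
  refine le_trans ?_ (Measure.le_map_apply (Measurable.aemeasurable (by fun_prop)) _)
  refine ENNReal.ofReal_le_of_le_toReal ?_
  rw [hS] at hmain
  refine hmain.trans (measureReal_mono fun w hw => ?_)
  refine ⟨fun k hk => (hw.1 k hk).trans_eq ?_, fun j hj => Eq.trans_le ?_ (hw.2 j hj)⟩
  all_goals exact congrArg _ (congrArg Finset.card (Finset.ext fun i => by simp [voteSet]))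
end

section
/- Let d, K, L be natural numbers with 1 ≤ K ≤ L < (d−K)/2, and set a = √(2·log((d−K)/(L−K+1))). Let Z₁,…,Z_{d−K} be independent standard Gaussian N(0,1) random variables. Then Pr[ #{ j ∈ [d−K] : Z_j > a } ≤ L − K ] ≥ 1/4. -/
open MeasureTheory ProbabilityTheory Real
open scoped Classical ENNReal

theorem gaussianReal_Ioi_zero_le_half : gaussianReal 0 1 (Set.Ioi 0) ≤ 1 / 2 := by
  have hsymm : gaussianReal 0 1 (Set.Iio 0) = gaussianReal 0 1 (Set.Ioi 0) := by
    have h := gaussianReal_map_neg (μ := 0) (v := 1)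
    rw [neg_zero] at h
    conv_lhs => rw [← h]
    rw [Measure.map_apply measurable_neg measurableSet_Iio]
    congr 1
    ext x
    simp
  have hdisj : Disjoint (Set.Iio (0 : ℝ)) (Set.Ioi 0) :=
    Set.disjoint_left.2 fun x hx hx' => lt_asymm (Set.mem_Iio.1 hx) (Set.mem_Ioi.1 hx')
  have h : gaussianReal 0 1 (Set.Iio 0 ∪ Set.Ioi 0) ≤ 1 := prob_le_one
  rw [measure_union hdisj measurableSet_Ioi, hsymm, ← two_mul, mul_comm] at h
  rwa [ENNReal.le_div_iff_mul_le (by simp) (by simp)]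

/-- The Gaussian tail bound `Pr[Z > a] ≤ exp (-a² / 2) / 2` for `a ≥ 0`. -/
theorem gaussianReal_Ioi_le {a : ℝ} (ha : 0 ≤ a) :
    gaussianReal 0 1 (Set.Ioi a) ≤ ENNReal.ofReal (exp (-a ^ 2 / 2)) * (1 / 2) := by
  have hshift : gaussianReal 0 1 (Set.Ioi a) = gaussianReal (-a) 1 (Set.Ioi 0) := by
    have h := gaussianReal_map_add_const (μ := 0) (v := 1) (-a)
    rw [zero_add] at h
    rw [← h, Measure.map_apply (measurable_add_const _) measurableSet_Ioi]
    congr 1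
    ext x
    simp
  calc gaussianReal 0 1 (Set.Ioi a)
      = ∫⁻ x in Set.Ioi 0, gaussianPDF (-a) 1 x := by
        rw [hshift, gaussianReal_apply _ one_ne_zero]
    _ ≤ ∫⁻ x in Set.Ioi 0, ENNReal.ofReal (exp (-a ^ 2 / 2)) * gaussianPDF 0 1 x := by
        refine setLIntegral_mono' measurableSet_Ioi fun x hx => ?_
        have hx : 0 < x := hx
        rw [gaussianPDF, gaussianPDF, ← ENNReal.ofReal_mul (exp_pos _).le]
        refine ENNReal.ofReal_le_ofReal ?_
        rw [gaussianPDFReal, gaussianPDFReal, mul_left_comm, ← exp_add]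
        gcongr
        simp only [NNReal.coe_one]
        nlinarith [mul_nonneg ha hx.le]
    _ = ENNReal.ofReal (exp (-a ^ 2 / 2)) * gaussianReal 0 1 (Set.Ioi 0) := by
        rw [lintegral_const_mul _ (measurable_gaussianPDF _ _),
          gaussianReal_apply _ one_ne_zero]
    _ ≤ _ := by
        gcongr
        exact gaussianReal_Ioi_zero_le_half

/-- Markov's inequality for the number of coordinates of an i.i.d. sample that lie in `s`. -/
theorem mul_pi_le_card_filter_mem_le {X : Type*} [MeasurableSpace X] (ν : Measure X)
    [IsProbabilityMeasure ν] {s : Set X} (hs : MeasurableSet s) (n m : ℕ) :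
    (m : ℝ≥0∞) * (Measure.pi fun _ : Fin n => ν)
      {z | m ≤ (Finset.univ.filter fun j => z j ∈ s).card} ≤ n * ν s := by
  have hcard (z : Fin n → X) : ((Finset.univ.filter fun j => z j ∈ s).card : ℝ≥0∞)
      = ∑ j, s.indicator 1 (z j) := by
    simp [Set.indicator_apply]
  have hmeas (j : Fin n) : Measurable fun z : Fin n → X => s.indicator (1 : X → ℝ≥0∞) (z j) :=
    (measurable_one.indicator hs).comp (measurable_pi_apply j)
  have hint (j : Fin n) :
      ∫⁻ z, s.indicator (1 : X → ℝ≥0∞) (z j) ∂(Measure.pi fun _ : Fin n => ν) = ν s := by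
    rw [(measurePreserving_eval (fun _ : Fin n => ν) j).lintegral_comp
      (f := s.indicator (1 : X → ℝ≥0∞)) (measurable_one.indicator hs), lintegral_indicator_one hs]
  have h := mul_meas_ge_le_lintegral (μ := Measure.pi fun _ : Fin n => ν)
    (Finset.measurable_fun_sum Finset.univ fun j _ => hmeas j) (m : ℝ≥0∞)
  rw [lintegral_finsetSum _ fun j _ => hmeas j] at h
  simpa only [hint, ← hcard, Nat.cast_le, Finset.sum_const, Finset.card_univ, Fintype.card_fin,
    nsmul_eq_mul] using h

/-- For `1 ≤ K ≤ L < (d−K)/2`, `a = √(2 log((d−K)/(L−K+1)))` and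
`Z₁,…,Z_{d−K}` i.i.d. standard Gaussians,
`Pr[#{j : Z_j > a} ≤ L − K] ≥ 1/4`. -/
theorem few_gaussians_above_threshold
    (d K L : ℕ) (hK : 1 ≤ K) (hKL : K ≤ L) (hL : (L : ℝ) < ((d : ℝ) - K) / 2) :
    (Measure.pi fun _ : Fin (d - K) => gaussianReal 0 1)
      {z | (Finset.univ.filter fun j : Fin (d - K) =>
              Real.sqrt (2 * Real.log (((d : ℝ) - K) / ((L : ℝ) - K + 1))) < z j).card
            ≤ L - K}
      ≥ (1 / 4 : ℝ≥0∞) := by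
  have hKd : K ≤ d := by
    have : (0 : ℝ) ≤ L := L.cast_nonneg
    have : (K : ℝ) ≤ d := by linarith
    exact_mod_cast this
  have hKr : (1 : ℝ) ≤ K := by exact_mod_cast hK
  have hn : ((d : ℝ) - K) = ((d - K : ℕ) : ℝ) := by rw [Nat.cast_sub hKd]
  have hm : ((L : ℝ) - K + 1) = ((L - K + 1 : ℕ) : ℝ) := by
    rw [Nat.cast_add, Nat.cast_sub hKL, Nat.cast_one]
  have hmn : ((L - K + 1 : ℕ) : ℝ) ≤ ((d - K : ℕ) : ℝ) := by
    rw [← hn, ← hm]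
    have : (0 : ℝ) ≤ L := L.cast_nonneg
    linarith
  rw [hn, hm]
  have hlt (x : ℕ) : x ≤ L - K ↔ ¬ L - K + 1 ≤ x := by omega
  simp only [hlt]
  generalize d - K = n at *
  have hmpos : 0 < L - K + 1 := Nat.succ_pos _
  generalize L - K + 1 = m at *
  have hm0 : (0 : ℝ) < m := by exact_mod_cast hmpos
  have hn0 : (0 : ℝ) < n := hm0.trans_le hmn
  set a := √(2 * log (n / m)) with ha
  have hexp : exp (-a ^ 2 / 2) = m / n := by
    have hlog : 0 ≤ log ((n : ℝ) / m) := log_nonneg ((one_le_div hm0).2 hmn)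
    rw [ha, sq_sqrt (by positivity), show -(2 * log ((n : ℝ) / m)) / 2 = -log (n / m) by ring,
      exp_neg, exp_log (by positivity), inv_div]
  have htail := gaussianReal_Ioi_le (sqrt_nonneg _ : 0 ≤ a)
  rw [hexp, ENNReal.ofReal_div_of_pos hn0, ENNReal.ofReal_natCast, ENNReal.ofReal_natCast] at htail
  have hmarkov := mul_pi_le_card_filter_mem_le (gaussianReal 0 1) (measurableSet_Ioi (a := a)) n m
  simp only [Set.mem_Ioi] at hmarkov
  set P := Measure.pi fun _ : Fin n => gaussianReal 0 1
  set B : Set (Fin n → ℝ) := {z | m ≤ (Finset.univ.filter fun j => a < z j).card}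
  have hhalf : P B ≤ 1 / 2 := by
    have hle : (m : ℝ≥0∞) * P B ≤ m * (1 / 2) := by
      refine (hmarkov.trans (mul_le_mul_right htail _)).trans_eq ?_
      rw [← mul_assoc, ENNReal.mul_div_cancel (by exact_mod_cast hn0.ne') (by simp)]
    exact (ENNReal.mul_le_mul_iff_right (by exact_mod_cast hm0.ne') (by simp)).1 hle
  have hcover : 1 ≤ P B + P Bᶜ := by
    rw [← measure_univ (μ := P), ← Set.union_compl_self B]
    exact measure_union_le _ _
  have hcompl : 1 / 2 ≤ P Bᶜ := by
    refine (ENNReal.add_le_add_iff_left (a := 1 / 2) (by simp)).1 ?_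
    rw [ENNReal.add_halves]
    exact hcover.trans (add_le_add_left hhalf _)
  refine le_trans ?_ hcompl
  exact ENNReal.div_le_div_left (by norm_num) 1
end

section
/- Let d, K, L be natural numbers with 1 ≤ K ≤ L and K < d. Let μ ∈ ℝ^d be supported on a set Ω ⊆ [d] with |Ω| = K and μ_j ≥ 0 for all j, and let x_j = μ_j + ε_j for j ∈ [d], where ε₁,…,ε_d are i.i.d. standard Gaussian N(0,1). Then for every fixed non-support coordinate j ∉ Ω, the probability that j is among the L largest coordinates of x satisfies Pr[ #{ k ≠ j : x_k > x_j } ≤ L − 1 ] ≤ L/(d−K). -/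
open MeasureTheory ProbabilityTheory Real
open scoped Classical

/-- At most `L` elements of a finite set have fewer than `L` elements of the set strictly above
them, when all values are distinct. -/
lemma card_filter_card_above_lt_le {ι : Type*} (T : Finset ι) (L : ℕ) (x : ι → ℝ)
    (hx : Function.Injective x) :
    (T.filter fun i => (T.filter fun k => x i < x k).card < L).card ≤ L := by
  by_contra! hL
  set A := T.filter fun i => (T.filter fun k => x i < x k).card < L
  obtain ⟨a, haA, hmin⟩ := A.exists_min_image x (Finset.card_pos.mp (by omega))
  have hsub : A.erase a ⊆ T.filter fun k => x a < x k := by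
    intro k hk
    obtain ⟨hka, hkA⟩ := Finset.mem_erase.mp hk
    exact Finset.mem_filter.mpr ⟨(Finset.mem_filter.mp hkA).1,
      lt_of_le_of_ne (hmin k hkA) fun h => hka (hx h).symm⟩
  have hcard := Finset.card_le_card hsub
  rw [Finset.card_erase_of_mem haA] at hcard
  have := (Finset.mem_filter.mp haA).2
  omega

/-- Independent samples from an atomless law on `ℝ` are almost surely distinct. -/
lemma ae_injective_pi {ι : Type*} [Fintype ι] (ν : Measure ℝ) [IsProbabilityMeasure ν]
    [NullSingletonClass ν] :
    ∀ᵐ x ∂(Measure.pi fun _ : ι => ν), Function.Injective x := by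
  have hne : ∀ i k : ι, i ≠ k → ∀ᵐ x ∂(Measure.pi fun _ : ι => ν), x i ≠ x k := by
    intro i k hik
    have hind : IndepFun (fun x : ι → ℝ => x i) (fun x => x k) (Measure.pi fun _ : ι => ν) :=
      (iIndepFun_pi (μ := fun _ : ι => ν) (X := fun _ => id) fun _ => aemeasurable_id).indepFun hik
    have hmap := hind.map_prod_eq_prod_map_map (measurable_pi_apply i).aemeasurable
      (measurable_pi_apply k).aemeasurable
    have heval (l : ι) : (Measure.pi fun _ : ι => ν).map (fun x => x l) = ν :=
      (measurePreserving_eval (fun _ : ι => ν) l).map_eq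
    rw [heval, heval] at hmap
    have hdiag : ∀ᵐ p ∂(ν.prod ν), p.1 ≠ p.2 := by
      refine Measure.measure_prod_null_of_ae_null (by measurability) (Filter.Eventually.of_forall fun a => ?_)
      have : Prod.mk a ⁻¹' {p : ℝ × ℝ | p.1 ≠ p.2}ᶜ = {a} := by
        ext b
        simp [eq_comm]
      simp [this]
    rw [← hmap] at hdiag
    exact ae_of_ae_map (f := fun x : ι → ℝ => (x i, x k))
      ((measurable_pi_apply i).prodMk (measurable_pi_apply k)).aemeasurable hdiag
  have hall : ∀ᵐ x ∂(Measure.pi fun _ : ι => ν), ∀ i k : ι, i ≠ k → x i ≠ x k := by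
    simp only [ae_all_iff]
    exact hne
  filter_upwards [hall] with x hx i k hik
  by_contra h
  exact hx i k h hik

lemma measurableSet_card_above_lt {ι : Type*} [Fintype ι] (T : Finset ι) (L : ℕ) (i : ι) :
    MeasurableSet {x : ι → ℝ | (T.filter fun k => x i < x k).card < L} := by
  simp only [Finset.card_filter]
  refine measurableSet_lt (Finset.measurable_sum _ fun k _ => ?_) measurable_const
  exact Measurable.ite (measurableSet_lt (measurable_pi_apply i) (measurable_pi_apply k))
    measurable_const measurable_const

/-- The rank of a coordinate within `T` has the same law for all coordinates in `T`. -/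
lemma measure_card_above_lt_eq {ι : Type*} [Fintype ι] (ν : Measure ℝ) [IsProbabilityMeasure ν]
    (T : Finset ι) (L : ℕ) {i j : ι} (hi : i ∈ T) (hj : j ∈ T) :
    (Measure.pi fun _ : ι => ν) {x | (T.filter fun k => x i < x k).card < L} =
      (Measure.pi fun _ : ι => ν) {x | (T.filter fun k => x j < x k).card < L} := by
  have hswap : ∀ k, k ∈ T → Equiv.swap i j k ∈ T := fun k hk => by
    rw [Equiv.swap_apply_def]
    split_ifs <;> assumption
  have hmp := measurePreserving_piCongrLeft (fun _ : ι => ν) (Equiv.swap i j)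
  rw [← hmp.measure_preimage (measurableSet_card_above_lt T L i).nullMeasurableSet]
  congr 1
  ext x
  have hval (k : ι) : MeasurableEquiv.piCongrLeft (fun _ : ι => ℝ) (Equiv.swap i j) x k =
      x (Equiv.swap i j k) := by
    conv_lhs => rw [← Equiv.swap_apply_self i j k]
    exact Equiv.piCongrLeft_apply_apply (fun _ : ι => ℝ) (Equiv.swap i j) x _
  have hcard : (T.filter fun k => x j < x (Equiv.swap i j k)).card =
      (T.filter fun k => x j < x k).card := by
    refine Finset.card_bij' (fun k _ => Equiv.swap i j k) (fun k _ => Equiv.swap i j k) ?_ ?_ ?_ ?_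
    · intro k hk
      rw [Finset.mem_filter] at hk ⊢
      exact ⟨hswap k hk.1, hk.2⟩
    · intro k hk
      rw [Finset.mem_filter] at hk ⊢
      exact ⟨hswap k hk.1, by simpa using hk.2⟩
    · simp
    · simp
  simp only [Set.mem_preimage, Set.mem_ofPred_eq, hval, Equiv.swap_apply_left, hcard]

/-- Among the coordinates in `T` of an i.i.d. atomless sample, a fixed one is among the `L` largest
with probability at most `L / #T`. -/
lemma card_mul_measure_card_above_lt_le {ι : Type*} [Fintype ι] (ν : Measure ℝ)
    [IsProbabilityMeasure ν] [NullSingletonClass ν] (T : Finset ι) (L : ℕ) {j : ι} (hj : j ∈ T) :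
    T.card * (Measure.pi fun _ : ι => ν) {x | (T.filter fun k => x j < x k).card < L} ≤ L := by
  set P := Measure.pi fun _ : ι => ν
  set F : ι → Set (ι → ℝ) := fun i => {x | (T.filter fun k => x i < x k).card < L} with hF
  calc (T.card : ENNReal) * P (F j) = ∑ i ∈ T, P (F i) := by
        rw [Finset.sum_congr rfl fun i hi => measure_card_above_lt_eq ν T L hi hj]
        simp [P, F]
    _ = ∫⁻ x, ∑ i ∈ T, (F i).indicator 1 x ∂P := by
        rw [lintegral_finsetSum _ fun i _ =>
          measurable_one.indicator (measurableSet_card_above_lt T L i)]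
        exact Finset.sum_congr rfl fun i _ =>
          (lintegral_indicator_one (measurableSet_card_above_lt T L i)).symm
    _ ≤ ∫⁻ _, L ∂P := by
        refine lintegral_mono_ae ?_
        filter_upwards [ae_injective_pi (ι := ι) ν] with x hx
        have hsum : ∑ i ∈ T, (F i).indicator (1 : (ι → ℝ) → ENNReal) x =
            ((T.filter fun i => (T.filter fun k => x i < x k).card < L).card : ENNReal) := by
          simp [Set.indicator_apply, hF, Finset.sum_boole]
        rw [hsum]
        exact_mod_cast card_filter_card_above_lt_le T L x hx
    _ = L := by simp [P]

/-- For a `K`-sparse nonnegative mean `μ` observed through i.i.d. standard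
Gaussian noise, the probability that a fixed non-support coordinate `j` is among the `L`
largest observed coordinates is at most `L/(d−K)`. -/
theorem nonsupport_in_topL_prob_le
    (d K L : ℕ) (hK1 : 1 ≤ K) (hKL : K ≤ L) (hKd : K < d)
    (S : Finset (Fin d)) (hS : S.card = K)
    (μ : Fin d → ℝ) (hμpos : ∀ k ∈ S, 0 < μ k) (hμ0 : ∀ k ∉ S, μ k = 0)
    (j : Fin d) (hj : j ∉ S) :
    (Measure.pi fun _ : Fin d => gaussianReal 0 1)
      {ε | (Finset.univ.filter fun k : Fin d =>
              k ≠ j ∧ μ j + ε j < μ k + ε k).card ≤ L - 1}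
      ≤ ENNReal.ofReal ((L : ℝ) / ((d : ℝ) - K)) := by
  have hcard : (Sᶜ.card : ℝ) = (d : ℝ) - K := by
    rw [Finset.card_compl, Fintype.card_fin, hS, Nat.cast_sub hKd.le]
  have hpos : 0 < (d : ℝ) - K := sub_pos.mpr (by exact_mod_cast hKd)
  have := nullSingletonClass_gaussianReal (μ := 0) (v := 1) one_ne_zero
  have hbound := card_mul_measure_card_above_lt_le (gaussianReal 0 1) Sᶜ L
    (Finset.mem_compl.mpr hj)
  rw [ENNReal.ofReal_div_of_pos hpos, ENNReal.ofReal_natCast, ← hcard, ENNReal.ofReal_natCast]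
  rw [ENNReal.le_div_iff_mul_le (Or.inl (by
    rw [← hcard] at hpos
    exact_mod_cast hpos.ne')) (Or.inl (ENNReal.natCast_ne_top _)), mul_comm]
  refine le_trans (mul_le_mul_right (measure_mono fun ε hε => ?_) _) hbound
  have hsub : (Sᶜ.filter fun k => ε j < ε k) ⊆
      Finset.univ.filter fun k => k ≠ j ∧ μ j + ε j < μ k + ε k := by
    intro k hk
    obtain ⟨hkS, hlt⟩ := Finset.mem_filter.mp hk
    refine Finset.mem_filter.mpr ⟨Finset.mem_univ k, fun h => (h ▸ hlt).false, ?_⟩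
    simpa [hμ0 j hj, hμ0 k (Finset.mem_compl.mp hkS)] using hlt
  have hle := (Finset.card_le_card hsub).trans hε
  simp only [Set.mem_ofPred_eq]
  omega
end

section
/- Fix natural numbers d ≥ 16 and K with K < d, and a real r with log 5 / log(d−K) < r < 1. Set M_eff = ⌈16·log d⌉ and t_m = √(2r·log(d−K)), and let t̂ be any real with t_m − 1/d ≤ t̂ ≤ t_m. Consider the distributed sparse normal means model with machines i = 1,…,M_eff: machine i observes x_{i,j} = μ_j + ε_{i,j}, where the ε_{i,j} are i.i.d. standard Gaussian N(0,1), μ is supported on a set Ω ⊆ [d] with |Ω| = K, μ_j ≥ √(2r·log(d−K)) for j ∈ Ω, and μ_j = 0 for j ∉ Ω. For each coordinate j define the vote count v_j = #{ i ∈ [M_eff] : x_{i,j} > t̂ }. Then with probability at least 1 − (K+1)/d, every k ∈ Ω satisfies v_k ≥ 4·log d and every j ∉ Ω satisfies v_j ≤ 4·log d. -/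
open MeasureTheory ProbabilityTheory Real
open scoped Classical ENNReal

lemma gaussianReal_Ioi_le_s9 {t : ℝ} (ht : 0 < t) :
    gaussianReal 0 1 (Set.Ioi t) ≤ ENNReal.ofReal (t⁻¹ * ((√(2 * π))⁻¹ * rexp (-(t ^ 2) / 2))) := by
  have hderiv : ∀ x ∈ Set.Ici t,
      HasDerivAt (fun x : ℝ => -(t⁻¹ * ((√(2 * π))⁻¹ * rexp (-(x ^ 2) / 2))))
        (t⁻¹ * ((√(2 * π))⁻¹ * (x * rexp (-(x ^ 2) / 2)))) x := by
    intro x _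
    have h : HasDerivAt (fun x : ℝ => -(x ^ 2) / 2) (-x) x := by
      have := ((hasDerivAt_pow 2 x).neg).div_const 2
      convert! this using 1
      push_cast
      ring
    convert! ((h.exp.const_mul _).const_mul _).neg using 1
    ring
  have hpos : ∀ x ∈ Set.Ioi t, 0 ≤ t⁻¹ * ((√(2 * π))⁻¹ * (x * rexp (-(x ^ 2) / 2))) := by
    intro x hx
    have : 0 < x := ht.trans hx
    positivity
  have hlim : Filter.Tendsto (fun x : ℝ => -(t⁻¹ * ((√(2 * π))⁻¹ * rexp (-(x ^ 2) / 2))))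
      Filter.atTop (nhds 0) := by
    have h : Filter.Tendsto (fun x : ℝ => -(x ^ 2) / 2) Filter.atTop Filter.atBot := by
      have h2 := (Filter.tendsto_pow_atTop (α := ℝ) two_ne_zero).const_mul_atTop_of_neg
        (r := -(1 / 2)) (by norm_num)
      refine h2.congr fun x => by ring
    simpa using (((tendsto_exp_atBot.comp h).const_mul (√(2 * π))⁻¹).const_mul t⁻¹).neg
  have hint := integrableOn_Ioi_deriv_of_nonneg' hderiv hpos hlim
  have hval := integral_Ioi_of_hasDerivAt_of_nonneg' hderiv hpos hlim
  rw [gaussianReal_apply_eq_integral _ one_ne_zero]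
  refine ENNReal.ofReal_le_ofReal ?_
  calc ∫ x in Set.Ioi t, gaussianPDFReal 0 1 x
      ≤ ∫ x in Set.Ioi t, t⁻¹ * ((√(2 * π))⁻¹ * (x * rexp (-(x ^ 2) / 2))) := by
        refine setIntegral_mono_on (integrable_gaussianPDFReal 0 1).integrableOn hint
          measurableSet_Ioi fun x hx => ?_
        have hx' : 1 ≤ t⁻¹ * x := by
          rw [inv_mul_eq_div, one_le_div ht]
          exact le_of_lt hx
        have hE : 0 ≤ (√(2 * π))⁻¹ * rexp (-(x ^ 2) / 2) := by positivity
        simp only [gaussianPDFReal, NNReal.coe_one, mul_one, sub_zero]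
        nlinarith
    _ = _ := by rw [hval]; ring

lemma gaussianReal_Ioi_le_one_div_sixteen {t : ℝ} (ht : 17 / 10 ≤ t) :
    gaussianReal 0 1 (Set.Ioi t) ≤ ENNReal.ofReal (1 / 16) := by
  refine (measure_mono (Set.Ioi_subset_Ioi ht)).trans <|
    (gaussianReal_Ioi_le_s9 (by norm_num)).trans <| ENNReal.ofReal_le_ofReal ?_
  have hs : (5 / 2 : ℝ) ≤ √(2 * π) := by
    apply Real.le_sqrt_of_sq_le
    nlinarith [Real.pi_gt_d2]
  have he : rexp (-((17 / 10 : ℝ) ^ 2) / 2) ≤ 1 / 4 := by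
    rw [← Real.le_log_iff_exp_le (by norm_num), show (1 / 4 : ℝ) = (2 ^ 2)⁻¹ by norm_num,
      Real.log_inv, Real.log_pow]
    have := Real.log_two_lt_d9
    push_cast
    linarith
  have hs' : (√(2 * π))⁻¹ ≤ 2 / 5 := by
    rw [show (2 / 5 : ℝ) = (5 / 2)⁻¹ by norm_num]
    exact inv_anti₀ (by norm_num) hs
  calc (17 / 10 : ℝ)⁻¹ * ((√(2 * π))⁻¹ * rexp (-((17 / 10 : ℝ) ^ 2) / 2))
      ≤ (17 / 10 : ℝ)⁻¹ * (2 / 5 * (1 / 4)) := by gcongr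
    _ ≤ 1 / 16 := by norm_num

lemma gaussianReal_Iic_zero_le : gaussianReal 0 1 (Set.Iic 0) ≤ 1 / 2 := by
  have := nullSingletonClass_gaussianReal (μ := 0) (v := 1) one_ne_zero
  have hsymm : gaussianReal 0 1 (Set.Iic 0) = gaussianReal 0 1 (Set.Ioi 0) := by
    have h := gaussianReal_map_neg (μ := 0) (v := 1)
    rw [neg_zero] at h
    conv_lhs => rw [← h, Measure.map_apply (by fun_prop) measurableSet_Iic]
    rw [show (fun x : ℝ => -x) ⁻¹' Set.Iic 0 = Set.Ici 0 by ext; simp,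
      ← measure_congr Ioi_ae_eq_Ici]
  have hadd : gaussianReal 0 1 (Set.Iic 0) + gaussianReal 0 1 (Set.Ioi 0) = 1 := by
    have := measure_add_measure_compl (μ := gaussianReal 0 1) (measurableSet_Iic (a := (0 : ℝ)))
    rwa [Set.compl_Iic, measure_univ] at this
  rw [← hsymm, ← two_mul] at hadd
  rw [ENNReal.le_div_iff_mul_le (by simp) (by simp), mul_comm, hadd]

/-- The number of samples of coordinate `j`, shifted by `m`, that exceed the threshold `t`. -/
noncomputable def voteCount {n d : ℕ} (t m : ℝ) (j : Fin d) (ε : Fin n × Fin d → ℝ) : ℕ :=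
  (Finset.univ.filter fun i : Fin n => t < m + ε (i, j)).card

lemma pow_voteCount_eq_prod {n d : ℕ} (t m c : ℝ) (j : Fin d) (ε : Fin n × Fin d → ℝ) :
    c ^ voteCount t m j ε = ∏ i : Fin n, if t < m + ε (i, j) then c else 1 := by
  simp [voteCount, Finset.prod_ite]

lemma lintegral_pow_voteCount {n d : ℕ} (t m : ℝ) {c : ℝ} (hc : 0 ≤ c) (j : Fin d) :
    ∫⁻ ε, ENNReal.ofReal (c ^ voteCount t m j ε)
        ∂(Measure.pi fun _ : Fin n × Fin d => gaussianReal 0 1) =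
      (ENNReal.ofReal c * gaussianReal 0 1 {x | t < m + x}
        + gaussianReal 0 1 {x | t < m + x}ᶜ) ^ n := by
  set P := Measure.pi fun _ : Fin n × Fin d => gaussianReal 0 1
  set g : ℝ → ℝ≥0∞ := fun x => if t < m + x then ENNReal.ofReal c else 1 with hg
  have hA : MeasurableSet {x : ℝ | t < m + x} := measurableSet_lt (by fun_prop) (by fun_prop)
  have hgm : Measurable g := Measurable.ite hA measurable_const measurable_const
  have hind : iIndepFun (fun (i : Fin n) (ε : Fin n × Fin d → ℝ) => g (ε (i, j))) P :=
    (iIndepFun_pi (μ := fun _ : Fin n × Fin d => gaussianReal 0 1) (X := fun _ => g)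
      (fun _ => hgm.aemeasurable)).precomp (g := fun i : Fin n => (i, j))
      fun a b h => (Prod.mk.inj h).1
  have hone : ∀ i : Fin n, ∫⁻ ε, g (ε (i, j)) ∂P =
      ENNReal.ofReal c * gaussianReal 0 1 {x | t < m + x}
        + gaussianReal 0 1 {x | t < m + x}ᶜ := by
    intro i
    rw [(measurePreserving_eval (fun _ : Fin n × Fin d => gaussianReal 0 1) (i, j)).lintegral_comp
      hgm, ← lintegral_add_compl _ hA,
      setLIntegral_congr_fun (f := g) (g := fun _ => ENNReal.ofReal c) hA fun x hx => if_pos hx,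
      setLIntegral_congr_fun (f := g) (g := fun _ => 1) hA.compl fun x hx => if_neg hx]
    simp
  have hfun : (fun ε : Fin n × Fin d → ℝ => ENNReal.ofReal (c ^ voteCount t m j ε)) =
      fun ε => ∏ i : Fin n, g (ε (i, j)) := by
    funext ε
    rw [pow_voteCount_eq_prod, ENNReal.ofReal_prod_of_nonneg fun i _ => by split_ifs <;> simp [hc]]
    refine Finset.prod_congr rfl fun i _ => ?_
    simp only [hg]
    split_ifs <;> simp
  rw [hfun, lintegral_prod_eq_prod_lintegral_of_indepFun _ _ hind
    fun i => hgm.comp (measurable_pi_apply _)]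
  simp [hone]

/-- Chernoff bound for the vote count of a coordinate. -/
lemma measure_voteCount_le {n d : ℕ} {t m c q a : ℝ} (hc : 0 < c) (hq : 0 ≤ q) (j : Fin d)
    (hcq : ENNReal.ofReal c * gaussianReal 0 1 {x | t < m + x}
        + gaussianReal 0 1 {x | t < m + x}ᶜ ≤ ENNReal.ofReal q)
    {E : Set (Fin n × Fin d → ℝ)} (hE : ∀ ε ∈ E, c ^ a ≤ c ^ (voteCount t m j ε : ℝ)) :
    (Measure.pi fun _ : Fin n × Fin d => gaussianReal 0 1) E ≤ ENNReal.ofReal (q ^ n / c ^ a) := by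
  have hca : 0 < c ^ a := Real.rpow_pos_of_pos hc a
  set P := Measure.pi fun _ : Fin n × Fin d => gaussianReal 0 1
  have hmeas : Measurable fun ε : Fin n × Fin d → ℝ => ENNReal.ofReal (c ^ voteCount t m j ε) := by
    simp_rw [pow_voteCount_eq_prod]
    refine ENNReal.measurable_ofReal.comp (Finset.measurable_prod _ fun i _ => ?_)
    exact Measurable.ite (measurableSet_lt (by fun_prop) (by fun_prop)) measurable_const
      measurable_const
  calc P E ≤ P {ε | ENNReal.ofReal (c ^ a) ≤ ENNReal.ofReal (c ^ voteCount t m j ε)} := by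
        refine measure_mono fun ε hε => ENNReal.ofReal_le_ofReal ?_
        simpa only [Real.rpow_natCast] using hE ε hε
    _ ≤ (∫⁻ ε, ENNReal.ofReal (c ^ voteCount t m j ε) ∂P) / ENNReal.ofReal (c ^ a) :=
        meas_ge_le_lintegral_div hmeas.aemeasurable (by simpa using hca) ENNReal.ofReal_ne_top
    _ ≤ ENNReal.ofReal (q ^ n) / ENNReal.ofReal (c ^ a) := by
        rw [lintegral_pow_voteCount t m hc.le, ENNReal.ofReal_pow hq]
        gcongr
    _ = _ := (ENNReal.ofReal_div_of_pos hca).symm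

lemma measure_voteCount_gt_le {n d : ℕ} (hd : 16 ≤ d) (hn : (n : ℝ) ≤ 16 * Real.log d + 1)
    {t : ℝ} (ht : 17 / 10 ≤ t) (j : Fin d) :
    (Measure.pi fun _ : Fin n × Fin d => gaussianReal 0 1)
      {ε | 4 * Real.log d < voteCount t 0 j ε} ≤ ENNReal.ofReal (1 / d ^ 2) := by
  have hd' : (16 : ℝ) ≤ d := by exact_mod_cast hd
  have hlog : 4 * Real.log 2 ≤ Real.log d := by
    rw [show 4 * Real.log 2 = Real.log (2 ^ 4) by rw [Real.log_pow]; norm_num]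
    exact Real.log_le_log (by norm_num) (by linarith)
  have hA : MeasurableSet {x : ℝ | t < 0 + x} := measurableSet_lt (by fun_prop) (by fun_prop)
  refine (measure_voteCount_le (t := t) (m := 0) (c := 4) (q := 19 / 16) (a := 4 * Real.log d)
    (by norm_num) (by norm_num) j ?_ fun ε hε => ?_).trans (ENNReal.ofReal_le_ofReal ?_)
  · have hp : gaussianReal 0 1 {x | t < 0 + x} ≤ ENNReal.ofReal (1 / 16) := by
      simpa [Set.Ioi] using gaussianReal_Ioi_le_one_div_sixteen ht
    have htot := measure_add_measure_compl (μ := gaussianReal 0 1) hA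
    rw [measure_univ] at htot
    rw [show ENNReal.ofReal 4 = ENNReal.ofReal 3 + 1 by
      rw [← ENNReal.ofReal_one, ← ENNReal.ofReal_add] <;> norm_num, add_mul, one_mul, add_assoc,
      htot]
    calc _ ≤ ENNReal.ofReal 3 * ENNReal.ofReal (1 / 16) + 1 := by gcongr
      _ = ENNReal.ofReal (19 / 16) := by
        rw [← ENNReal.ofReal_mul (by norm_num), ← ENNReal.ofReal_one,
          ← ENNReal.ofReal_add (by norm_num) (by norm_num)]
        norm_num
  · exact Real.rpow_le_rpow_of_exponent_le (by norm_num) (le_of_lt hε)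
  · have h2 := Real.log_two_gt_d9
    have h16 : 16 * Real.log (19 / 16) ≤ 4 * Real.log 2 := by
      have : Real.log ((19 / 16) ^ 16) ≤ Real.log (2 ^ 4) :=
        Real.log_le_log (by norm_num) (by norm_num)
      simpa only [Real.log_pow, Nat.cast_ofNat] using this
    have h0 : 0 ≤ Real.log (19 / 16) := Real.log_nonneg (by norm_num)
    have h1 : Real.log 4 = 2 * Real.log 2 := by
      rw [show (4 : ℝ) = 2 ^ 2 by norm_num, Real.log_pow]; norm_num
    rw [← Real.log_le_log_iff (by positivity) (by positivity), Real.log_div (by positivity)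
      (by positivity), Real.log_pow, Real.log_rpow (by norm_num), one_div, Real.log_inv,
      Real.log_pow, h1]
    push_cast
    nlinarith

lemma measure_voteCount_lt_le {n d : ℕ} (hd : 16 ≤ d) (hn : 16 * Real.log d ≤ n)
    {t m : ℝ} (htm : t ≤ m) (j : Fin d) :
    (Measure.pi fun _ : Fin n × Fin d => gaussianReal 0 1)
      {ε | (voteCount t m j ε : ℝ) < 4 * Real.log d} ≤ ENNReal.ofReal (1 / d) := by
  have hd' : (16 : ℝ) ≤ d := by exact_mod_cast hd
  have hlog : 0 ≤ Real.log d := Real.log_nonneg (by linarith)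
  have hA : MeasurableSet {x : ℝ | t < m + x} := measurableSet_lt (by fun_prop) (by fun_prop)
  refine (measure_voteCount_le (t := t) (m := m) (c := 1 / 2) (q := 3 / 4) (a := 4 * Real.log d)
    (by norm_num) (by norm_num) j ?_ fun ε hε => ?_).trans (ENNReal.ofReal_le_ofReal ?_)
  · have hp : gaussianReal 0 1 {x | t < m + x}ᶜ ≤ ENNReal.ofReal (1 / 2) := by
      refine (measure_mono (t := Set.Iic 0) fun x hx => ?_).trans
        (gaussianReal_Iic_zero_le.trans_eq ?_)
      · simp only [Set.mem_compl_iff, Set.mem_ofPred_eq, not_lt] at hx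
        simp only [Set.mem_Iic]
        linarith
      · rw [ENNReal.ofReal_div_of_pos (by norm_num)]; simp
    have htot := measure_add_measure_compl (μ := gaussianReal 0 1) hA
    rw [measure_univ] at htot
    have hhalf : ENNReal.ofReal (1 / 2) + ENNReal.ofReal (1 / 2) = 1 := by
      rw [← ENNReal.ofReal_add (by norm_num) (by norm_num)]; norm_num
    calc _ = ENNReal.ofReal (1 / 2) * (gaussianReal 0 1 {x | t < m + x}
            + gaussianReal 0 1 {x | t < m + x}ᶜ)
            + ENNReal.ofReal (1 / 2) * gaussianReal 0 1 {x | t < m + x}ᶜ := by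
          rw [mul_add, add_assoc, ← add_mul, hhalf, one_mul]
      _ ≤ ENNReal.ofReal (1 / 2) * 1 + ENNReal.ofReal (1 / 2) * ENNReal.ofReal (1 / 2) := by
          rw [htot]; gcongr
      _ = ENNReal.ofReal (3 / 4) := by
          rw [mul_one, ← ENNReal.ofReal_mul (by norm_num),
            ← ENNReal.ofReal_add (by norm_num) (by norm_num)]
          norm_num
  · exact Real.rpow_le_rpow_of_exponent_ge (by norm_num) (by norm_num) (le_of_lt hε)
  · have h2 := Real.log_two_gt_d9
    have h3 := Real.log_three_lt_d9
    have h34 : Real.log (3 / 4) = Real.log 3 - 2 * Real.log 2 := by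
      rw [Real.log_div (by norm_num) (by norm_num), show (4 : ℝ) = 2 ^ 2 by norm_num,
        Real.log_pow]
      norm_num
    have h2' := Real.log_two_lt_d9
    rw [← Real.log_le_log_iff (by positivity) (by positivity), Real.log_div (by positivity)
      (by positivity), Real.log_pow, Real.log_rpow (by norm_num), one_div, one_div, Real.log_inv,
      Real.log_inv, h34]
    nlinarith

lemma seventeen_div_ten_le_sqrt_sub {d : ℕ} (hd : 16 ≤ d) {s : ℝ} (hs : Real.log 5 < s) :
    17 / 10 ≤ √(2 * s) - 1 / d := by
  have hd' : (1 : ℝ) / d ≤ 1 / 16 :=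
    one_div_le_one_div_of_le (by norm_num) (by exact_mod_cast hd)
  have : (17 / 10 + 1 / 16 : ℝ) ≤ √(2 * s) := by
    apply Real.le_sqrt_of_sq_le
    linarith [Real.log_five_gt_d9]
  linarith

/-- Theorem 3.2a, thresholding with `⌈16 log d⌉` machines: in the distributed
sparse normal means model with threshold `t̂ ∈ [t_m − 1/d, t_m]`, `t_m = √(2r log(d−K))`,
with probability at least `1 − (K+1)/d` every support coordinate receives at least
`4 log d` votes while every non-support coordinate receives at most `4 log d` votes, where
machine `i` votes for every coordinate whose sample exceeds `t̂`. -/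
theorem thresholding_support_recovery_logd_machines
    (d K : ℕ) (hd : 16 ≤ d) (hKd : K < d)
    (r : ℝ) (hrl : Real.log 5 / Real.log ((d : ℝ) - K) < r) (hr1 : r < 1)
    (Meff : ℕ) (hMeff : Meff = ⌈16 * Real.log d⌉₊)
    (tm tHat : ℝ) (htm : tm = Real.sqrt (2 * r * Real.log ((d : ℝ) - K)))
    (htHat1 : tm - 1 / d ≤ tHat) (htHat2 : tHat ≤ tm)
    (S : Finset (Fin d)) (hS : S.card = K)
    (μ : Fin d → ℝ)
    (hμS : ∀ k ∈ S, Real.sqrt (2 * r * Real.log ((d : ℝ) - K)) ≤ μ k)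
    (hμ0 : ∀ j ∉ S, μ j = 0) :
    (Measure.pi fun _ : Fin Meff × Fin d => gaussianReal 0 1)
      {ε | (∀ k ∈ S, 4 * Real.log d ≤
              ((Finset.univ.filter fun i : Fin Meff => tHat < μ k + ε (i, k)).card : ℝ))
           ∧ ∀ j ∉ S,
              ((Finset.univ.filter fun i : Fin Meff => tHat < μ j + ε (i, j)).card : ℝ)
                ≤ 4 * Real.log d}
      ≥ ENNReal.ofReal (1 - ((K : ℝ) + 1) / d) := by
  have hd0 : (16 : ℝ) ≤ d := by exact_mod_cast hd
  have hK1 : (K : ℝ) + 1 ≤ d := by exact_mod_cast hKd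
  rcases eq_or_lt_of_le hK1 with hK | hK
  · rw [hK, div_self (by positivity)]
    simp
  have hL : 0 < Real.log ((d : ℝ) - K) := Real.log_pos (by linarith)
  have ht : 17 / 10 ≤ tHat := by
    rw [div_lt_iff₀ hL] at hrl
    have := seventeen_div_ten_le_sqrt_sub hd hrl
    rw [← mul_assoc, ← htm] at this
    exact this.trans htHat1
  have hlog : 0 ≤ Real.log d := Real.log_nonneg (by linarith)
  have hM1 : 16 * Real.log d ≤ Meff := hMeff ▸ Nat.le_ceil _
  have hM2 : (Meff : ℝ) ≤ 16 * Real.log d + 1 :=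
    hMeff ▸ (Nat.ceil_lt_add_one (by positivity)).le
  set P := Measure.pi fun _ : Fin Meff × Fin d => gaussianReal 0 1
  set G : Set (Fin Meff × Fin d → ℝ) :=
    {ε | (∀ k ∈ S, 4 * Real.log d ≤ (voteCount tHat (μ k) k ε : ℝ)) ∧
      ∀ j ∉ S, (voteCount tHat (μ j) j ε : ℝ) ≤ 4 * Real.log d} with hG
  change P G ≥ ENNReal.ofReal (1 - ((K : ℝ) + 1) / d)
  have hbad : P Gᶜ ≤ ENNReal.ofReal (((K : ℝ) + 1) / d) := by
    have hsub : Gᶜ ⊆ (⋃ k ∈ S, {ε | (voteCount tHat (μ k) k ε : ℝ) < 4 * Real.log d}) ∪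
        ⋃ j ∈ Sᶜ, {ε | 4 * Real.log d < (voteCount tHat 0 j ε : ℝ)} := by
      intro ε hε
      by_contra hcon
      simp only [Set.mem_union, Set.mem_iUnion, Set.mem_ofPred_eq, Finset.mem_compl, not_or,
        not_exists, not_lt] at hcon
      refine hε ⟨hcon.1, fun j hj => ?_⟩
      rw [hμ0 j hj]
      exact hcon.2 j hj
    calc P Gᶜ ≤ ∑ k ∈ S, P {ε | (voteCount tHat (μ k) k ε : ℝ) < 4 * Real.log d}
            + ∑ j ∈ Sᶜ, P {ε | 4 * Real.log d < (voteCount tHat 0 j ε : ℝ)} :=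
          (measure_mono hsub).trans <| (measure_union_le _ _).trans <|
            add_le_add (measure_biUnion_finset_le _ _) (measure_biUnion_finset_le _ _)
      _ ≤ ∑ _k ∈ S, ENNReal.ofReal (1 / d) + ∑ _j : Fin d, ENNReal.ofReal (1 / d ^ 2) := by
          refine add_le_add (Finset.sum_le_sum fun k hk => ?_)
            ((Finset.sum_le_sum fun j _ => measure_voteCount_gt_le hd hM2 ht j).trans
              (Finset.sum_le_sum_of_subset (Finset.subset_univ _)))
          exact measure_voteCount_lt_le hd hM1 (htHat2.trans (htm.trans_le (hμS k hk))) k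
      _ = ENNReal.ofReal (((K : ℝ) + 1) / d) := by
          rw [← ENNReal.ofReal_sum_of_nonneg fun _ _ => by positivity,
            ← ENNReal.ofReal_sum_of_nonneg fun _ _ => by positivity,
            ← ENNReal.ofReal_add (by positivity) (by positivity)]
          congr 1
          simp only [Finset.sum_const, hS, Finset.card_univ, Fintype.card_fin, nsmul_eq_mul]
          field_simp
  rw [ge_iff_le, ENNReal.ofReal_sub _ (by positivity), ENNReal.ofReal_one, tsub_le_iff_right]
  calc (1 : ℝ≥0∞) = P (G ∪ Gᶜ) := by rw [Set.union_compl_self, measure_univ]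
    _ ≤ P G + P Gᶜ := measure_union_le _ _
    _ ≤ _ := by gcongr
end

section
/- Fix natural numbers d ≥ 15, K < d, and M with 32·√(eπ)·(log d)^{3/2} ≤ M ≤ d, and a real r < 1 satisfying r > ( √(2·log(5M/(√(2π)·4·log d))) − √(2·log(M/(32·√π·(log d)^{3/2}))) + 1/d )² / (2·log(d−K)). Set t_m = √(2r·log(d−K)) + √(2·log(M/(32·√π·(log d)^{3/2}))), and let t̂ be any real with t_m − 1/d ≤ t̂ ≤ t_m. Consider the distributed sparse normal means model with machines i = 1,…,M: machine i observes x_{i,j} = μ_j + ε_{i,j}, where the ε_{i,j} are i.i.d. standard Gaussian N(0,1), μ is supported on a set Ω ⊆ [d] with |Ω| = K, μ_j ≥ √(2r·log(d−K)) for j ∈ Ω, and μ_j = 0 for j ∉ Ω. For each coordinate j define the vote count v_j = #{ i ∈ [M] : x_{i,j} > t̂ }. Then with probability at least 1 − (K+1)/d, every k ∈ Ω satisfies v_k ≥ 4·log d and every j ∉ Ω satisfies v_j ≤ 4·log d. -/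
open MeasureTheory ProbabilityTheory Real
open scoped Classical ENNReal

lemma gaussianPDFReal_zero_one (x : ℝ) :
    gaussianPDFReal 0 1 x = (√(2 * π))⁻¹ * exp (-x ^ 2 / 2) := by
  simp [gaussianPDFReal]

lemma hasDerivAt_gaussianPDFReal_zero_one (x : ℝ) :
    HasDerivAt (gaussianPDFReal 0 1) (-x * gaussianPDFReal 0 1 x) x := by
  have h : HasDerivAt (fun y : ℝ => (√(2 * π))⁻¹ * exp (-y ^ 2 / 2))
      ((√(2 * π))⁻¹ * (exp (-x ^ 2 / 2) * (-(2 * x) / 2))) x := by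
    have h1 : HasDerivAt (fun y : ℝ => -y ^ 2 / 2) (-(2 * x) / 2) x := by
      simpa using ((hasDerivAt_pow 2 x).neg.div_const 2)
    exact h1.exp.const_mul _
  convert h using 1
  · ext y; exact gaussianPDFReal_zero_one y
  · rw [gaussianPDFReal_zero_one]; ring

lemma tendsto_gaussianPDFReal_zero_one :
    Filter.Tendsto (gaussianPDFReal 0 1) Filter.atTop (nhds 0) := by
  have h : Filter.Tendsto (fun y : ℝ => (√(2 * π))⁻¹ * exp (-(y ^ 2 / 2))) Filter.atTop
      (nhds ((√(2 * π))⁻¹ * 0)) := by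
    refine Filter.Tendsto.const_mul _ (tendsto_exp_neg_atTop_nhds_zero.comp ?_)
    exact (Filter.tendsto_pow_atTop two_ne_zero).atTop_div_const two_pos
  rw [mul_zero] at h
  refine h.congr fun y => ?_
  rw [gaussianPDFReal_zero_one, neg_div]

lemma gaussianReal_zero_one_real_apply (s : Set ℝ) :
    (gaussianReal 0 1).real s = ∫ x in s, gaussianPDFReal 0 1 x := by
  rw [measureReal_def, gaussianReal_apply_eq_integral 0 one_ne_zero,
    ENNReal.toReal_ofReal (integral_nonneg fun x => gaussianPDFReal_nonneg _ _ x)]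

/-- A crude upper bound for the standard Gaussian tail. -/
lemma gaussianReal_Ioi_le_s10 {b : ℝ} (hb : 1 ≤ b) :
    (gaussianReal 0 1).real (Set.Ioi b) ≤ gaussianPDFReal 0 1 b := by
  have hderiv : ∀ x ∈ Set.Ici b, HasDerivAt (fun y => -gaussianPDFReal 0 1 y)
      (x * gaussianPDFReal 0 1 x) x := fun x _ => by
    simpa using (hasDerivAt_gaussianPDFReal_zero_one x).fun_neg
  have hnonneg : ∀ x ∈ Set.Ioi b, 0 ≤ x * gaussianPDFReal 0 1 x := fun x hx =>
    mul_nonneg (by linarith [Set.mem_Ioi.1 hx]) (gaussianPDFReal_nonneg _ _ x)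
  have hlim : Filter.Tendsto (fun y => -gaussianPDFReal 0 1 y) Filter.atTop (nhds (-0)) :=
    tendsto_gaussianPDFReal_zero_one.neg
  have hint := integrableOn_Ioi_deriv_of_nonneg' hderiv hnonneg hlim
  have heq := integral_Ioi_of_hasDerivAt_of_nonneg' hderiv hnonneg hlim
  rw [gaussianReal_zero_one_real_apply]
  calc ∫ x in Set.Ioi b, gaussianPDFReal 0 1 x
      ≤ ∫ x in Set.Ioi b, x * gaussianPDFReal 0 1 x := by
        refine setIntegral_mono_on (integrable_gaussianPDFReal 0 1).integrableOn hint
          measurableSet_Ioi fun x hx => ?_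
        exact le_mul_of_one_le_left (gaussianPDFReal_nonneg _ _ x)
          (by linarith [Set.mem_Ioi.1 hx])
    _ = gaussianPDFReal 0 1 b := by rw [heq]; ring

/-- A lower bound of Mills-ratio type for the standard Gaussian tail. -/
lemma le_gaussianReal_Ioi {a : ℝ} (ha : 1 ≤ a) :
    gaussianPDFReal 0 1 a / (2 * a) ≤ (gaussianReal 0 1).real (Set.Ioi a) := by
  have hderiv : ∀ x ∈ Set.Ici a, HasDerivAt (fun y => -(gaussianPDFReal 0 1 y / (2 * y)))
      (gaussianPDFReal 0 1 x * (1 / 2 + 1 / (2 * x ^ 2))) x := fun x hx => by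
    have hx0 : x ≠ 0 := by linarith [Set.mem_Ici.1 hx]
    have h := ((hasDerivAt_gaussianPDFReal_zero_one x).fun_div
      ((hasDerivAt_id' x).const_mul 2) (by simpa using hx0)).fun_neg
    refine h.congr_deriv ?_
    generalize gaussianPDFReal 0 1 x = y
    field_simp
    ring
  have hnonneg : ∀ x ∈ Set.Ioi a, 0 ≤ gaussianPDFReal 0 1 x * (1 / 2 + 1 / (2 * x ^ 2)) :=
    fun x _ => mul_nonneg (gaussianPDFReal_nonneg _ _ x) (by positivity)
  have hlim : Filter.Tendsto (fun y => -(gaussianPDFReal 0 1 y / (2 * y))) Filter.atTop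
      (nhds (-0)) :=
    (tendsto_gaussianPDFReal_zero_one.div_atTop
      (Filter.tendsto_id.const_mul_atTop two_pos)).neg
  have hint := integrableOn_Ioi_deriv_of_nonneg' hderiv hnonneg hlim
  have heq := integral_Ioi_of_hasDerivAt_of_nonneg' hderiv hnonneg hlim
  rw [gaussianReal_zero_one_real_apply]
  calc gaussianPDFReal 0 1 a / (2 * a)
      = ∫ x in Set.Ioi a, gaussianPDFReal 0 1 x * (1 / 2 + 1 / (2 * x ^ 2)) := by
        rw [heq]; ring
    _ ≤ ∫ x in Set.Ioi a, gaussianPDFReal 0 1 x := by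
        refine setIntegral_mono_on hint (integrable_gaussianPDFReal 0 1).integrableOn
          measurableSet_Ioi fun x hx => ?_
        have hx1 : 1 ≤ x ^ 2 := by nlinarith [Set.mem_Ioi.1 hx]
        refine mul_le_of_le_one_right (gaussianPDFReal_nonneg _ _ x) ?_
        have : 1 / (2 * x ^ 2) ≤ 1 / 2 := one_div_le_one_div_of_le two_pos (by linarith)
        linarith

lemma card_filter_lt_eq_sum {ι Ω : Type*} [Fintype ι] (Y : ι → Ω → ℝ) (c : ℝ) :
    (fun ω => ((Finset.univ.filter fun i => c < Y i ω).card : ℝ)) =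
      ∑ i, (Set.Ioi c).indicator (1 : ℝ → ℝ) ∘ Y i := by
  ext ω
  simp [Set.indicator_apply, Finset.sum_apply]

section Counting

variable {ι Ω : Type*} [Fintype ι] [MeasurableSpace Ω] {P : Measure Ω} {Y : ι → Ω → ℝ} {c p : ℝ}

lemma measurable_card_filter_lt (hY : ∀ i, Measurable (Y i)) :
    Measurable fun ω => ((Finset.univ.filter fun i => c < Y i ω).card : ℝ) := by
  rw [card_filter_lt_eq_sum, Finset.sum_fn]
  exact Finset.measurable_sum _ fun i _ =>
    ((measurable_one (α := ℝ) (β := ℝ)).indicator measurableSet_Ioi).comp (hY i)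

lemma integrable_exp_mul_card_filter_lt [IsFiniteMeasure P] (hY : ∀ i, Measurable (Y i)) (t : ℝ) :
    Integrable (fun ω => exp (t * ((Finset.univ.filter fun i => c < Y i ω).card : ℝ))) P := by
  refine Integrable.of_bound
    ((measurable_card_filter_lt hY).const_mul t).exp.aestronglyMeasurable
    (exp (|t| * Fintype.card ι)) (ae_of_all _ fun ω => ?_)
  rw [Real.norm_eq_abs, abs_exp, exp_le_exp]
  refine mul_le_mul (le_abs_self t) ?_ (Nat.cast_nonneg _) (abs_nonneg t)
  exact_mod_cast Finset.card_le_univ _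

lemma mgf_indicator_Ioi [IsProbabilityMeasure P] {Z : Ω → ℝ} (hZ : Measurable Z) (t : ℝ) :
    mgf ((Set.Ioi c).indicator 1 ∘ Z) P t =
      1 + P.real {ω | c < Z ω} * (exp t - 1) := by
  have hs : MeasurableSet {ω | c < Z ω} := measurableSet_lt measurable_const hZ
  have h : (fun ω => exp (t * ((Set.Ioi c).indicator 1 ∘ Z) ω)) =
      fun ω => 1 + {ω | c < Z ω}.indicator (fun _ => exp t - 1) ω := by
    ext ω
    by_cases hω : c < Z ω <;> simp [hω]
  rw [mgf, h, integral_add (integrable_const _) ((integrable_const _).indicator hs),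
    integral_indicator_const _ hs]
  simp

/-- The moment generating function of a binomial count is at most that of a Poisson variable
with the same mean. -/
lemma mgf_card_filter_lt_le [IsProbabilityMeasure P] (hY : ∀ i, Measurable (Y i))
    (hind : iIndepFun Y P) (hp : ∀ i, P.real {ω | c < Y i ω} = p) (t : ℝ) :
    mgf (fun ω => ((Finset.univ.filter fun i => c < Y i ω).card : ℝ)) P t ≤
      exp (Fintype.card ι * p * (exp t - 1)) := by
  have hm : Measurable ((Set.Ioi c).indicator (1 : ℝ → ℝ)) :=
    measurable_one.indicator measurableSet_Ioi
  rw [card_filter_lt_eq_sum, (hind.comp _ fun _ => hm).mgf_sum fun i => hm.comp (hY i)]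
  calc ∏ i, mgf ((Set.Ioi c).indicator 1 ∘ Y i) P t
      ≤ ∏ _i : ι, exp (p * (exp t - 1)) := by
        refine Finset.prod_le_prod (fun i _ => mgf_nonneg) fun i _ => ?_
        rw [mgf_indicator_Ioi (hY i), hp, add_comm]
        exact add_one_le_exp _
    _ = exp (Fintype.card ι * p * (exp t - 1)) := by
        rw [Finset.prod_const, Finset.card_univ, ← exp_nat_mul, mul_assoc]

/-- A count whose mean is at most `4L/5` exceeds `4L` with probability at most `exp (-2L)`. -/
lemma measureReal_lt_card_filter_le [IsProbabilityMeasure P] (hY : ∀ i, Measurable (Y i))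
    (hind : iIndepFun Y P) (hp : ∀ i, P.real {ω | c < Y i ω} = p) {L : ℝ} (hL : 0 ≤ L)
    (hmean : Fintype.card ι * p ≤ 4 * L / 5) :
    P.real {ω | 4 * L < ((Finset.univ.filter fun i => c < Y i ω).card : ℝ)} ≤ exp (-2 * L) := by
  calc P.real {ω | 4 * L < ((Finset.univ.filter fun i => c < Y i ω).card : ℝ)}
      ≤ P.real {ω | 4 * L ≤ ((Finset.univ.filter fun i => c < Y i ω).card : ℝ)} :=
        measureReal_mono (Set.ofPred_subset_ofPred.2 fun ω hω => le_of_lt hω)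
    _ ≤ exp (-1 * (4 * L)) * exp (Fintype.card ι * p * (exp 1 - 1)) :=
        (measure_ge_le_exp_mul_mgf _ zero_le_one (integrable_exp_mul_card_filter_lt hY 1)).trans
          (by gcongr; exact mgf_card_filter_lt_le hY hind hp 1)
    _ ≤ exp (-2 * L) := by
        rw [← exp_add, exp_le_exp]
        have he := exp_one_lt_d9
        have he' := exp_one_gt_d9
        have h1 : Fintype.card ι * p * (exp 1 - 1) ≤ 4 * L / 5 * (exp 1 - 1) :=
          mul_le_mul_of_nonneg_right hmean (by linarith)
        nlinarith

/-- A count whose mean is at least `8L` falls below `4L` with probability at most `exp (-L)`. -/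
lemma measureReal_card_filter_lt_le [IsProbabilityMeasure P] (hY : ∀ i, Measurable (Y i))
    (hind : iIndepFun Y P) (hp : ∀ i, P.real {ω | c < Y i ω} = p) {L : ℝ} (hL : 0 ≤ L)
    (hmean : 8 * L ≤ Fintype.card ι * p) :
    P.real {ω | ((Finset.univ.filter fun i => c < Y i ω).card : ℝ) < 4 * L} ≤ exp (-L) := by
  calc P.real {ω | ((Finset.univ.filter fun i => c < Y i ω).card : ℝ) < 4 * L}
      ≤ P.real {ω | ((Finset.univ.filter fun i => c < Y i ω).card : ℝ) ≤ 4 * L} :=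
        measureReal_mono (Set.ofPred_subset_ofPred.2 fun ω hω => le_of_lt hω)
    _ ≤ exp (-(-1) * (4 * L)) * exp (Fintype.card ι * p * (exp (-1) - 1)) :=
        (measure_le_le_exp_mul_mgf _ (by norm_num)
          (integrable_exp_mul_card_filter_lt hY (-1))).trans
          (by gcongr; exact mgf_card_filter_lt_le hY hind hp (-1))
    _ ≤ exp (-L) := by
        rw [← exp_add, exp_le_exp]
        have he : exp (-1) ≤ 3 / 8 := by
          rw [exp_neg, inv_le_comm₀ (exp_pos 1) (by norm_num)]
          linarith [exp_one_gt_d9]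
        have h1 : Fintype.card ι * p * (exp (-1) - 1) ≤ 8 * L * (exp (-1) - 1) :=
          mul_le_mul_of_nonpos_right hmean (by linarith)
        nlinarith

end Counting

/-- The observations of one coordinate by all machines are independent. -/
lemma iIndepFun_pi_column {m n : Type*} [Fintype m] [Fintype n] (j : n) :
    iIndepFun (fun (i : m) (ε : m × n → ℝ) => ε (i, j))
      (Measure.pi fun _ : m × n => gaussianReal 0 1) :=
  (iIndepFun_pi (X := fun _ => id) (μ := fun _ : m × n => gaussianReal 0 1)
    fun _ => aemeasurable_id).precomp (g := fun i => (i, j)) fun _ _ h => (Prod.ext_iff.1 h).1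

lemma measureReal_pi_gaussian_lt {κ : Type*} [Fintype κ] (k : κ) (c : ℝ) :
    (Measure.pi fun _ : κ => gaussianReal 0 1).real {ε | c < ε k} =
      (gaussianReal 0 1).real (Set.Ioi c) :=
  (measurePreserving_eval (fun _ : κ => gaussianReal 0 1) k).measureReal_preimage
    measurableSet_Ioi.nullMeasurableSet

lemma gaussianPDFReal_sqrt_two_mul_log {B : ℝ} (hB : 1 ≤ B) :
    gaussianPDFReal 0 1 √(2 * log B) = (√(2 * π) * B)⁻¹ := by
  have hlog := log_nonneg hB
  rw [gaussianPDFReal_zero_one, sq_sqrt (by positivity), neg_div, mul_div_cancel_left₀ _ two_ne_zero,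
    exp_neg, exp_log (by linarith), mul_inv]

lemma one_le_sqrt_two_mul_log {B : ℝ} (hB : √(exp 1) ≤ B) : 1 ≤ √(2 * log B) := by
  have hpos : 0 < √(exp 1) := sqrt_pos.2 (exp_pos 1)
  have h := log_le_log hpos hB
  rw [log_sqrt (exp_pos 1).le, log_exp] at h
  exact one_le_sqrt.2 (by linarith)

lemma one_le_sqrt_exp_one : 1 ≤ √(exp 1) := one_le_sqrt.2 (one_le_exp zero_le_one)

/-- Mean number of votes of a support coordinate at the threshold `√(2 log A)`. -/
lemma eight_mul_le_mul_gaussianReal_Ioi {M L A : ℝ} (hL : 1 ≤ L)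
    (hA : A = M / (32 * √π * L ^ ((3 : ℝ) / 2))) (hA1 : √(exp 1) ≤ A) (hA2 : log A ≤ L) :
    8 * L ≤ M * (gaussianReal 0 1).real (Set.Ioi √(2 * log A)) := by
  have hA' := one_le_sqrt_exp_one.trans hA1
  have ha := one_le_sqrt_two_mul_log hA1
  have hA0 : 0 < A := by linarith
  have hπ : 0 < √π := sqrt_pos.2 pi_pos
  have hs : 0 < √L := sqrt_pos.2 (by linarith)
  have h2 : 0 < √(2 : ℝ) := by positivity
  have hL32 : L ^ ((3 : ℝ) / 2) = L * √L := by
    rw [sqrt_eq_rpow, show (3 : ℝ) / 2 = 1 + 1 / 2 by norm_num, rpow_add (by linarith), rpow_one]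
  have hM : M = A * (32 * √π * (L * √L)) := by
    rw [hA, hL32, div_mul_cancel₀]; positivity
  have haL : √(2 * log A) ≤ √2 * √L := by
    rw [← sqrt_mul zero_le_two]; gcongr
  have htail := le_gaussianReal_Ioi ha
  rw [gaussianPDFReal_sqrt_two_mul_log hA', sqrt_mul zero_le_two] at htail
  have hM0 : 0 ≤ M := by rw [hM]; positivity
  refine le_trans ?_ (mul_le_mul_of_nonneg_left htail hM0)
  rw [hM]
  have h22 : √(2 : ℝ) * √2 = 2 := mul_self_sqrt zero_le_two
  have ha0 : 0 < √(2 * log A) := by linarith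
  rw [show A * (32 * √π * (L * √L)) * ((√2 * √π * A)⁻¹ / (2 * √(2 * log A))) =
    16 * L * √L / (√2 * √(2 * log A)) by field_simp; norm_num, le_div_iff₀ (by positivity)]
  calc 8 * L * (√2 * √(2 * log A)) ≤ 8 * L * (√2 * (√2 * √L)) := by gcongr
    _ = 16 * L * √L := by rw [← mul_assoc √2, h22]; ring

/-- Mean number of votes of a non-support coordinate at the threshold `√(2 log B)`. -/
lemma mul_gaussianReal_Ioi_le {M L B : ℝ} (hM : 0 < M) (hL : 0 < L)
    (hB : B = 5 * M / (√(2 * π) * (4 * L))) (hB1 : √(exp 1) ≤ B) :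
    M * (gaussianReal 0 1).real (Set.Ioi √(2 * log B)) ≤ 4 * L / 5 := by
  have htail := gaussianReal_Ioi_le_s10 (one_le_sqrt_two_mul_log hB1)
  rw [gaussianPDFReal_sqrt_two_mul_log (one_le_sqrt_exp_one.trans hB1)] at htail
  refine (mul_le_mul_of_nonneg_left htail hM.le).trans_eq ?_
  have : 0 < √(2 * π) := by positivity
  rw [hB]
  field_simp

/-- Theorem 3.2b, thresholding with all `M` machines: in the distributed
sparse normal means model with `32√(eπ)(log d)^{3/2} ≤ M ≤ d` machines, SNR `r` above the
stated bound, and threshold `t̂ ∈ [t_m − 1/d, t_m]` where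
`t_m = √(2r log(d−K)) + √(2 log(M/(32√π (log d)^{3/2})))`, with probability at least
`1 − (K+1)/d` every support coordinate receives at least `4 log d` votes while every
non-support coordinate receives at most `4 log d` votes. -/
theorem thresholding_support_recovery_M_machines
    (d K M : ℕ) (hd : 15 ≤ d) (hKd : K < d)
    (hM1 : 32 * Real.sqrt (Real.exp 1 * Real.pi) * Real.log d ^ ((3 : ℝ) / 2) ≤ (M : ℝ))
    (hM2 : M ≤ d)
    (r : ℝ) (hr1 : r < 1)
    (hrl : (Real.sqrt (2 * Real.log (5 * M / (Real.sqrt (2 * Real.pi) * (4 * Real.log d)))) -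
              Real.sqrt (2 * Real.log ((M : ℝ) / (32 * Real.sqrt Real.pi * Real.log d ^ ((3 : ℝ) / 2)))) +
              1 / d) ^ 2 / (2 * Real.log ((d : ℝ) - K)) < r)
    (tm tHat : ℝ)
    (htm : tm = Real.sqrt (2 * r * Real.log ((d : ℝ) - K)) +
        Real.sqrt (2 * Real.log ((M : ℝ) / (32 * Real.sqrt Real.pi * Real.log d ^ ((3 : ℝ) / 2)))))
    (htHat1 : tm - 1 / d ≤ tHat) (htHat2 : tHat ≤ tm)
    (S : Finset (Fin d)) (hS : S.card = K)
    (μ : Fin d → ℝ)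
    (hμS : ∀ k ∈ S, Real.sqrt (2 * r * Real.log ((d : ℝ) - K)) ≤ μ k)
    (hμ0 : ∀ j ∉ S, μ j = 0) :
    (Measure.pi fun _ : Fin M × Fin d => gaussianReal 0 1)
      {ε | (∀ k ∈ S, 4 * Real.log d ≤
              ((Finset.univ.filter fun i : Fin M => tHat < μ k + ε (i, k)).card : ℝ))
           ∧ ∀ j ∉ S,
              ((Finset.univ.filter fun i : Fin M => tHat < μ j + ε (i, j)).card : ℝ)
                ≤ 4 * Real.log d}
      ≥ ENNReal.ofReal (1 - ((K : ℝ) + 1) / d) := by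
  set L := log d
  have hdR : (15 : ℝ) ≤ d := by exact_mod_cast hd
  have hd0 : (0 : ℝ) < d := by linarith
  have hL : 1 ≤ L := (le_log_iff_exp_le hd0).2 (by linarith [exp_one_lt_d9])
  have hL32 : L ≤ L ^ ((3 : ℝ) / 2) := by
    simpa using rpow_le_rpow_of_exponent_le hL (show (1 : ℝ) ≤ 3 / 2 by norm_num)
  have hπ : 1 ≤ √π := one_le_sqrt.2 (by linarith [pi_gt_three])
  have hM0 : (0 : ℝ) < M := lt_of_lt_of_le (by positivity) hM1
  rw [sqrt_mul (exp_pos 1).le] at hM1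
  set A := (M : ℝ) / (32 * √π * L ^ ((3 : ℝ) / 2)) with hA
  set B := 5 * (M : ℝ) / (√(2 * π) * (4 * L)) with hB
  set s := √(2 * r * log ((d : ℝ) - K))
  have hA1 : √(exp 1) ≤ A := by
    rw [hA, le_div_iff₀ (by positivity)]
    linarith
  have hA2 : log A ≤ L := by
    refine log_le_log (by positivity) ?_
    rw [hA, div_le_iff₀ (by positivity)]
    have h1 : (1 : ℝ) ≤ 32 * √π * L ^ ((3 : ℝ) / 2) := by nlinarith
    have h2 : (M : ℝ) ≤ d := by exact_mod_cast hM2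
    nlinarith
  have hB1 : √(exp 1) ≤ B := by
    rw [hB, le_div_iff₀ (by positivity), sqrt_mul zero_le_two]
    have h2 : √(2 : ℝ) ≤ 2 := by
      rw [sqrt_le_left zero_le_two]; norm_num
    calc √(exp 1) * (√2 * √π * (4 * L)) ≤ √(exp 1) * (2 * √π * (4 * L ^ ((3 : ℝ) / 2))) := by
          gcongr
      _ ≤ 5 * (32 * (√(exp 1) * √π) * L ^ ((3 : ℝ) / 2)) := by
          have : 0 ≤ √(exp 1) * √π * L ^ ((3 : ℝ) / 2) := by positivity
          linarith
      _ ≤ 5 * M := by linarith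
  set P := Measure.pi fun _ : Fin M × Fin d => gaussianReal 0 1
  have hcount : ∀ (j : Fin d) (ε : Fin M × Fin d → ℝ),
      (Finset.univ.filter fun i : Fin M => tHat < μ j + ε (i, j)) =
        Finset.univ.filter fun i : Fin M => tHat - μ j < ε (i, j) := fun j ε => by
    ext i; simp [sub_lt_iff_lt_add']
  simp only [hcount]
  have hmeas : ∀ (j : Fin d) (i : Fin M), Measurable fun ε : Fin M × Fin d → ℝ => ε (i, j) :=
    fun j i => measurable_pi_apply (i, j)
  have hsupp : ∀ k ∈ S, P.real {ε | ((Finset.univ.filter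
      fun i : Fin M => tHat - μ k < ε (i, k)).card : ℝ) < 4 * L} ≤ 1 / d := fun k hk => by
    refine (measureReal_card_filter_lt_le (hmeas k) (iIndepFun_pi_column k)
      (fun i => measureReal_pi_gaussian_lt (i, k) _) (by linarith) ?_).trans_eq ?_
    · rw [Fintype.card_fin]
      refine (eight_mul_le_mul_gaussianReal_Ioi hL hA hA1 hA2).trans ?_
      exact mul_le_mul_of_nonneg_left
        (measureReal_mono (Set.Ioi_subset_Ioi (by linarith [hμS k hk]))) hM0.le
    · rw [exp_neg, exp_log hd0, one_div]
  rw [ge_iff_le, ENNReal.ofReal_le_iff_le_toReal (measure_ne_top _ _), ← measureReal_def]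
  rcases Nat.lt_or_ge (K + 1) d with hK | hK
  swap
  · have hK' : (d : ℝ) ≤ K + 1 := by exact_mod_cast hK
    exact le_trans (sub_nonpos.2 ((one_le_div hd0).2 hK')) measureReal_nonneg
  have hK' : (K : ℝ) + 1 < d := by exact_mod_cast hK
  have hlog : 0 < log ((d : ℝ) - K) := log_pos (by linarith)
  have hthr : √(2 * log B) ≤ tHat := by
    rw [div_lt_iff₀ (by positivity)] at hrl
    have h : √(2 * log B) - √(2 * log A) + 1 / d ≤ s :=
      le_sqrt_of_sq_le (by linarith)
    linarith
  have hnull : ∀ j ∈ Sᶜ, P.real {ε | 4 * L < ((Finset.univ.filter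
      fun i : Fin M => tHat - μ j < ε (i, j)).card : ℝ)} ≤ 1 / d ^ 2 := fun j hj => by
    refine (measureReal_lt_card_filter_le (hmeas j) (iIndepFun_pi_column j)
      (fun i => measureReal_pi_gaussian_lt (i, j) _) (by linarith) ?_).trans_eq ?_
    · rw [Fintype.card_fin, hμ0 j (Finset.mem_compl.1 hj), sub_zero]
      refine le_trans ?_ (mul_gaussianReal_Ioi_le hM0 (by linarith) hB hB1)
      exact mul_le_mul_of_nonneg_left (measureReal_mono (Set.Ioi_subset_Ioi hthr)) hM0.le
    · rw [show -2 * L = -((2 : ℕ) * L) by push_cast; ring, exp_neg, exp_nat_mul, exp_log hd0,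
        one_div]
  set G := {ε : Fin M × Fin d → ℝ | _}
  set U := ⋃ k ∈ S, {ε : Fin M × Fin d → ℝ | ((Finset.univ.filter
      fun i : Fin M => tHat - μ k < ε (i, k)).card : ℝ) < 4 * L} with hU
  set V := ⋃ j ∈ Sᶜ, {ε : Fin M × Fin d → ℝ | 4 * L < ((Finset.univ.filter
      fun i : Fin M => tHat - μ j < ε (i, j)).card : ℝ)} with hV
  have hcover : Set.univ ⊆ G ∪ (U ∪ V) := fun ε _ => by
    by_contra hε
    simp only [Set.mem_union, not_or, hU, hV, Set.mem_iUnion, Set.mem_ofPred_eq, not_exists,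
      not_lt, Finset.mem_compl] at hε
    exact hε.1 ⟨hε.2.1, hε.2.2⟩
  have hone : 1 ≤ P.real G + (P.real U + P.real V) := by
    calc 1 = P.real Set.univ := probReal_univ.symm
      _ ≤ P.real (G ∪ (U ∪ V)) := measureReal_mono hcover
      _ ≤ P.real G + P.real (U ∪ V) := measureReal_union_le _ _
      _ ≤ _ := by gcongr; exact measureReal_union_le _ _
  have hUle : P.real U ≤ K * (1 / d) := by
    refine (measureReal_biUnion_finset_le _ _).trans
      ((Finset.sum_le_card_nsmul _ _ _ hsupp).trans ?_)
    rw [hS, nsmul_eq_mul]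
  have hVle : P.real V ≤ d * (1 / d ^ 2) := by
    refine (measureReal_biUnion_finset_le _ _).trans
      ((Finset.sum_le_card_nsmul _ _ _ hnull).trans ?_)
    rw [nsmul_eq_mul]
    gcongr
    simpa using Finset.card_le_univ Sᶜ
  have hsum : (K : ℝ) * (1 / d) + d * (1 / d ^ 2) = (K + 1) / d := by
    field_simp
  linarith
end

section
/- Let d ≥ 5 be a natural number, γ > 0 a real, μ a real with 0 ≤ μ ≤ d^γ, and T a real with T ≥ d^γ + √(4(γ+1)·log d). Then (1/√(2π)) · ∫_T^∞ x²·e^{−(x−μ)²/2} dx ≤ 1/(2d). -/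
open MeasureTheory Real

open Filter Topology in
lemma tendsto_add_mul_exp_neg_sq_div_two (c : ℝ) :
    Tendsto (fun y : ℝ => (y + c) * exp (-y ^ 2 / 2)) atTop (𝓝 0) := by
  have h1 := tendsto_pow_mul_exp_neg_atTop_nhds_zero 1
  have h0 := (tendsto_pow_mul_exp_neg_atTop_nhds_zero 0).const_mul |c|
  have h := h1.add h0
  simp only [pow_one, pow_zero, one_mul, mul_zero, add_zero] at h
  refine squeeze_zero_norm' ?_ h
  filter_upwards [eventually_ge_atTop (2 : ℝ)] with y hy
  rw [norm_mul, Real.norm_eq_abs, Real.norm_eq_abs, abs_exp, ← add_mul]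
  have hexp : exp (-y ^ 2 / 2) ≤ exp (-y) := exp_le_exp.2 (by nlinarith)
  have habs : |y + c| ≤ y + |c| := by
    simpa [abs_of_nonneg (by linarith : (0 : ℝ) ≤ y)] using abs_add_le y c
  gcongr

/-- A Mills-ratio type bound for the second moment of the tail of a shifted Gaussian. -/
lemma setIntegral_Ioi_sq_mul_exp_le {μ D s T : ℝ} (hμ : 0 ≤ μ) (hμD : μ ≤ D) (hs : 0 < s)
    (hT : μ + s ≤ T) :
    ∫ x in Set.Ioi T, x ^ 2 * exp (-(x - μ) ^ 2 / 2)
      ≤ (s + (2 * D + (1 + D ^ 2) / s)) * exp (-s ^ 2 / 2) := by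
  set c : ℝ := 2 * D + (1 + D ^ 2) / s with hc
  set G : ℝ → ℝ := fun x => -(((x - μ) + c) * exp (-(x - μ) ^ 2 / 2)) with hG
  set G' : ℝ → ℝ := fun x => ((x - μ) * ((x - μ) + c) - 1) * exp (-(x - μ) ^ 2 / 2) with hG'
  have hderiv : ∀ x, HasDerivAt G (G' x) x := by
    intro x
    have h1 : HasDerivAt (fun x : ℝ => x - μ) 1 x := (hasDerivAt_id x).sub_const μ
    have h2 : HasDerivAt (fun x : ℝ => -(x - μ) ^ 2 / 2) (-(x - μ)) x := by
      refine ((h1.pow 2).neg.div_const 2).congr_deriv ?_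
      norm_num
      ring
    refine ((h1.add_const c).mul h2.exp).neg.congr_deriv ?_
    simp only [hG']
    ring
  have hle : ∀ x ∈ Set.Ioi (μ + s), x ^ 2 * exp (-(x - μ) ^ 2 / 2) ≤ G' x := by
    intro x hx
    have hx' : s ≤ x - μ := by linarith [Set.mem_Ioi.1 hx]
    refine mul_le_mul_of_nonneg_right ?_ (exp_pos _).le
    have hq : 1 + D ^ 2 ≤ (x - μ) * ((1 + D ^ 2) / s) := by
      rw [mul_div_assoc', le_div_iff₀ hs]
      nlinarith [mul_le_mul_of_nonneg_left hx' (by positivity : 0 ≤ 1 + D ^ 2)]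
    have hx2 : x ^ 2 ≤ (x - μ + D) ^ 2 := by
      apply pow_le_pow_left₀ <;> linarith
    rw [hc]
    nlinarith
  have hnonneg : ∀ x ∈ Set.Ioi (μ + s), 0 ≤ G' x := fun x hx =>
    (by positivity : 0 ≤ x ^ 2 * exp (-(x - μ) ^ 2 / 2)).trans (hle x hx)
  have hlim : Filter.Tendsto G Filter.atTop (nhds 0) := by
    have := ((tendsto_add_mul_exp_neg_sq_div_two c).comp
      (Filter.tendsto_atTop_add_const_right _ (-μ) Filter.tendsto_id)).neg
    simpa [hG, Function.comp_def, sub_eq_add_neg] using this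
  have hInt : IntegrableOn G' (Set.Ioi (μ + s)) :=
    integrableOn_Ioi_deriv_of_nonneg' (fun x _ => hderiv x) hnonneg hlim
  have hsub : Set.Ioi T ⊆ Set.Ioi (μ + s) := Set.Ioi_subset_Ioi hT
  calc ∫ x in Set.Ioi T, x ^ 2 * exp (-(x - μ) ^ 2 / 2)
      ≤ ∫ x in Set.Ioi T, G' x := by
        refine integral_mono_of_nonneg (.of_forall fun x => by positivity) (hInt.mono_set hsub) ?_
        exact (ae_restrict_iff' measurableSet_Ioi).2 (.of_forall fun x hx => hle x (hsub hx))
    _ ≤ ∫ x in Set.Ioi (μ + s), G' x :=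
        setIntegral_mono_set hInt
          ((ae_restrict_iff' measurableSet_Ioi).2 (.of_forall hnonneg)) hsub.eventuallyLE
    _ = (s + c) * exp (-s ^ 2 / 2) := by
        rw [integral_Ioi_of_hasDerivAt_of_nonneg' (fun x _ => hderiv x) hnonneg hlim]
        simp [hG]

/-- For `d ≥ 5`, `γ > 0`, `0 ≤ μ ≤ d^γ` and `T ≥ d^γ + √(4(γ+1) log d)`,
`(1/√(2π)) ∫_T^∞ x² e^{−(x−μ)²/2} dx ≤ 1/(2d)`. -/
theorem gaussian_second_moment_tail
    (d : ℕ) (hd : 5 ≤ d) (γ : ℝ) (hγ : 0 < γ)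
    (μ T : ℝ) (hμ0 : 0 ≤ μ) (hμ1 : μ ≤ (d : ℝ) ^ γ)
    (hT : (d : ℝ) ^ γ + Real.sqrt (4 * (γ + 1) * Real.log d) ≤ T) :
    (1 / Real.sqrt (2 * Real.pi)) * ∫ x in Set.Ioi T, x ^ 2 * Real.exp (-(x - μ) ^ 2 / 2)
      ≤ 1 / (2 * d) := by
  have hd5 : (5 : ℝ) ≤ d := by exact_mod_cast hd
  have hd0 : (0 : ℝ) < d := by linarith
  set L : ℝ := log d with hL
  set D : ℝ := (d : ℝ) ^ γ with hD
  set s : ℝ := √(4 * (γ + 1) * L) with hs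
  have hL1 : 1 ≤ L := by
    rw [hL, le_log_iff_exp_le hd0]
    linarith [exp_one_lt_d9]
  have hLd : L ≤ d / 4 + 0.3864 := by
    have h4 : log (4 : ℝ) = 2 * log 2 := by
      rw [show (4 : ℝ) = 2 ^ 2 by norm_num, log_pow]
      norm_num
    have h := log_le_sub_one_of_pos (by positivity : (0 : ℝ) < d / 4)
    rw [log_div hd0.ne' (by norm_num), h4] at h
    linarith [log_two_lt_d9]
  have hDexp : D = exp (L * γ) := rpow_def_of_pos hd0 γ
  have hD1 : 1 ≤ D := one_le_rpow (by linarith) hγ.le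
  have hD4 : γ + 1 ≤ D ^ 4 := by
    rw [hDexp, ← exp_nat_mul]
    have := add_one_le_exp (((4 : ℕ) : ℝ) * (L * γ))
    push_cast at this ⊢
    nlinarith
  have hs2 : s ^ 2 = 4 * (γ + 1) * L := sq_sqrt (by positivity)
  have hs_ge : 2 ≤ s := le_sqrt_of_sq_le (by nlinarith)
  have hs0 : 0 < s := by linarith
  have hs_le : s ≤ D ^ 2 * (L + 1) := by
    refine sqrt_le_iff.2 ⟨by positivity, ?_⟩
    calc 4 * (γ + 1) * L ≤ 4 * D ^ 4 * L := by gcongr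
      _ ≤ (D ^ 2 * (L + 1)) ^ 2 := by
        nlinarith [mul_nonneg (by positivity : 0 ≤ D ^ 4) (sq_nonneg (L - 1))]
  have hexp : exp (-s ^ 2 / 2) = 1 / (D ^ 2 * d ^ 2) := by
    have hdexp : (d : ℝ) = exp L := (exp_log hd0).symm
    rw [hs2, hDexp, hdexp, ← exp_nat_mul, ← exp_nat_mul, ← exp_add, one_div, ← exp_neg]
    congr 1
    push_cast
    ring
  have hfactor : s + (2 * D + (1 + D ^ 2) / s) ≤ D ^ 2 * (5 / 4 * d) := by
    have hquot : (1 + D ^ 2) / s ≤ D ^ 2 := by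
      rw [div_le_iff₀ hs0]
      nlinarith
    nlinarith [mul_le_mul_of_nonneg_left hLd (sq_nonneg D),
      mul_le_mul_of_nonneg_left hd5 (sq_nonneg D)]
  have hpi : 5 / 2 ≤ √(2 * π) := le_sqrt_of_sq_le (by nlinarith [pi_gt_d2])
  have hInt : ∫ x in Set.Ioi T, x ^ 2 * exp (-(x - μ) ^ 2 / 2) ≤ 5 / 4 / d := by
    refine (setIntegral_Ioi_sq_mul_exp_le hμ0 hμ1 hs0 (by linarith)).trans ?_
    rw [hexp]
    calc _ ≤ D ^ 2 * (5 / 4 * d) * (1 / (D ^ 2 * d ^ 2)) := by gcongr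
      _ = 5 / 4 / d := by
        field_simp
  calc _ ≤ 1 / (5 / 2) * (5 / 4 / (d : ℝ)) := by gcongr
    _ = 1 / (2 * d) := by
      field_simp
      norm_num
end

section
/- Let M be a natural number, τ > 0 a real, and p a real with 0 ≤ p ≤ τ/(5M), and let v be a Binomial(M, p) random variable. Then Pr[ v > τ ] ≤ e^{−8τ/15}. -/
open MeasureTheory Real

/-- If `p ^ M` is the probability of some event and `M ≠ 0`, then `p ≤ 1`. -/
theorem le_one_of_measure_eq_pow {Ω : Type*} [MeasurableSpace Ω] (P : Measure Ω)
    [IsProbabilityMeasure P] {M : ℕ} (hM : M ≠ 0) {p : ℝ} {s : Set Ω}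
    (hs : P s = ENNReal.ofReal (p ^ M)) : p ≤ 1 := by
  by_contra! hp
  have h : ENNReal.ofReal (p ^ M) ≤ 1 := hs ▸ prob_le_one
  rw [ENNReal.ofReal_le_one] at h
  exact h.not_gt (one_lt_pow₀ hp hM)

/-- The exponential moment of a binomial distribution, as a finite sum. -/
theorem sum_exp_mul_binomial (M : ℕ) (p l : ℝ) :
    ∑ m ∈ Finset.range (M + 1),
      exp (l * m) * ((M.choose m : ℝ) * p ^ m * (1 - p) ^ (M - m)) =
      (p * exp l + (1 - p)) ^ M := by
  rw [add_pow]
  refine Finset.sum_congr rfl fun m _ => ?_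
  rw [mul_pow, ← exp_nat_mul, mul_comm l]
  ring

/-- The Chernoff bound for a binomial random variable, with a free parameter `l ≥ 0`. -/
theorem measure_lt_le_exp_of_binomial {Ω : Type*} [MeasurableSpace Ω] (P : Measure Ω)
    (M : ℕ) (τ p : ℝ) (hp0 : 0 ≤ p) (hp1 : p ≤ 1) (v : Ω → ℕ)
    (hbin : ∀ m : ℕ,
      P {ω | v ω = m} =
        ENNReal.ofReal ((M.choose m : ℝ) * p ^ m * (1 - p) ^ (M - m)))
    {l : ℝ} (hl : 0 ≤ l) :
    P {ω | τ < (v ω : ℝ)} ≤ ENNReal.ofReal (exp (M * p * (exp l - 1) - l * τ)) := by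
  set w : ℕ → ℝ := fun m => (M.choose m : ℝ) * p ^ m * (1 - p) ^ (M - m) with hw
  have hq : 0 ≤ 1 - p := sub_nonneg.2 hp1
  have hw0 (m : ℕ) : 0 ≤ w m := by positivity
  have hsub : {ω | τ < (v ω : ℝ)} ⊆ ⋃ m : ℕ, {ω | v ω = m ∧ τ < (m : ℝ)} := fun ω h =>
    Set.mem_iUnion.2 ⟨v ω, rfl, h⟩
  have hterm (m : ℕ) :
      P {ω | v ω = m ∧ τ < (m : ℝ)} ≤ ENNReal.ofReal (exp (l * m - l * τ) * w m) := by
    by_cases h : τ < (m : ℝ)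
    · simp only [h, and_true, hbin]
      refine ENNReal.ofReal_le_ofReal (le_mul_of_one_le_left (hw0 m) (one_le_exp ?_))
      rw [← mul_sub]
      exact mul_nonneg hl (sub_nonneg.2 h.le)
    · simp [h]
  have hbase : p * exp l + (1 - p) ≤ exp (p * (exp l - 1)) := by
    linarith [add_one_le_exp (p * (exp l - 1))]
  calc
    P {ω | τ < (v ω : ℝ)} ≤ ∑' m : ℕ, P {ω | v ω = m ∧ τ < (m : ℝ)} :=
      (measure_mono hsub).trans (measure_iUnion_le _)
    _ ≤ ∑' m : ℕ, ENNReal.ofReal (exp (l * m - l * τ) * w m) := ENNReal.tsum_le_tsum hterm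
    _ = ∑ m ∈ Finset.range (M + 1), ENNReal.ofReal (exp (l * m - l * τ) * w m) := by
      refine tsum_eq_sum fun m hm => ?_
      have : M < m := by simpa [Nat.lt_succ_iff] using hm
      simp [hw, Nat.choose_eq_zero_of_lt this]
    _ = ENNReal.ofReal (exp (-(l * τ)) * (p * exp l + (1 - p)) ^ M) := by
      rw [← ENNReal.ofReal_sum_of_nonneg fun m _ => mul_nonneg (exp_pos _).le (hw0 m),
        ← sum_exp_mul_binomial, Finset.mul_sum]
      congr 1
      refine Finset.sum_congr rfl fun m _ => ?_
      rw [sub_eq_neg_add, exp_add, mul_assoc]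
    _ ≤ ENNReal.ofReal (exp (-(l * τ)) * exp (p * (exp l - 1)) ^ M) := by
      gcongr
    _ = ENNReal.ofReal (exp (M * p * (exp l - 1) - l * τ)) := by
      rw [← exp_nat_mul, ← exp_add]
      ring_nf

/-- If `v ~ Binomial(M, p)` with `0 ≤ p ≤ τ/(5M)` and `τ > 0`, then
`Pr[v > τ] ≤ e^{−8τ/15}`. -/
theorem binomial_tail_chernoff
    {Ω : Type*} [MeasurableSpace Ω] (P : Measure Ω) [IsProbabilityMeasure P]
    (M : ℕ) (τ : ℝ) (hτ : 0 < τ)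
    (p : ℝ) (hp0 : 0 ≤ p) (hp1 : p ≤ τ / (5 * M))
    (v : Ω → ℕ) (hmeas : Measurable v)
    (hbin : ∀ m : ℕ,
      P {ω | v ω = m} =
        ENNReal.ofReal ((M.choose m : ℝ) * p ^ m * (1 - p) ^ (M - m))) :
    P {ω | τ < (v ω : ℝ)} ≤ ENNReal.ofReal (Real.exp (-(8 * τ) / 15)) := by
  have hMp : M * p ≤ τ / 5 := by
    rcases eq_or_ne M 0 with rfl | hM
    · simp only [Nat.cast_zero, zero_mul]
      positivity
    · have hM' : (0 : ℝ) < M := by positivity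
      rw [le_div_iff₀ (by positivity)] at hp1
      linarith
  have hp : p ≤ 1 := by
    rcases eq_or_ne M 0 with rfl | hM
    · simp only [Nat.cast_zero, mul_zero, div_zero] at hp1
      linarith
    · exact le_one_of_measure_eq_pow P hM (by simpa using hbin M)
  refine (measure_lt_le_exp_of_binomial P M τ p hp0 hp v hbin zero_le_one).trans ?_
  refine ENNReal.ofReal_le_ofReal (exp_le_exp.2 ?_)
  have he : exp 1 - 1 ≤ 7 / 3 := by linarith [exp_one_lt_d9]
  have he0 : 0 ≤ exp 1 - 1 := sub_nonneg.2 (one_le_exp zero_le_one)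
  have h : M * p * (exp 1 - 1) ≤ τ / 5 * (7 / 3) :=
    mul_le_mul hMp he he0 (by positivity)
  linarith
end
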